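/- Let n ≥ 1 be an integer, and let p, q > 1 be reals, with the additional restriction p, q ≤ n/(n-2) when n ≥ 3. Assume α_N := max{(q/2 + 1)/(pq - 1), (2 + 1/p)/(pq - 1), (1/2 + p)/(pq - 1) - 1/2} > (n-1)/2. Let u₀, u₁, v₀, v₁ : ℝⁿ → ℝ be continuous, nonnegative, supported in the closed ball B_R of radius R > 0, with u₀ and v₁ not identically zero. Then there exist constants ε₀ > 0 and C > 0 such that for every ε ∈ (0, ε₀] and every T > 0: if (u, v) is a classical solution of the system u_tt - Δu + u_t = |v|^p, v_tt - Δv = |u|^q on [0,T) × ℝⁿ with initial data (u, u_t, v, v_t)(0,·) = ε(u₀, u₁, v₀, v₁) and with supp u, supp v contained in {(t,x) : |x| ≤ R + t}, then T ≤ C ε^{-1/F(n,p,q)}, where F(n,p,q) := max{F₁, F₂, F₃, F₄} with F₁ := (2 + 1/p)/(pq - 1) - (n-1)/2, F₂ := (1 + 2/q)/(pq - 1) - (n-1)/q, F₃ := (2 + q)/(pq - 1) - n + 1, F₄ := (1 + 2p)/(pq - 1) - n. -/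

import Mathlib

open Real Set

/-- The Laplacian of a function on `ℝⁿ` (Euclidean space), as the sum of the second
partial derivatives in the coordinate directions. -/
noncomputable def laplacian {n : ℕ} (f : EuclideanSpace ℝ (Fin n) → ℝ)
    (x : EuclideanSpace ℝ (Fin n)) : ℝ :=
  ∑ i : Fin n,
    fderiv ℝ (fun y => fderiv ℝ f y (EuclideanSpace.single i 1)) x (EuclideanSpace.single i 1)

/-- `(u, v)` is a classical solution of Nakao's problem
`u_tt - Δu + u_t = |v|^p`, `v_tt - Δv = |u|^q` on `[0, T) × ℝⁿ`:
both components are twice continuously differentiable (jointly in `(t,x)`) and the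
equations hold pointwise for `t ∈ [0, T)`. -/
def IsNakaoSolution {n : ℕ} (p q T : ℝ) (u v : ℝ → EuclideanSpace ℝ (Fin n) → ℝ) : Prop :=
  ContDiff ℝ 2 (fun z : ℝ × EuclideanSpace ℝ (Fin n) => u z.1 z.2) ∧
  ContDiff ℝ 2 (fun z : ℝ × EuclideanSpace ℝ (Fin n) => v z.1 z.2) ∧
  (∀ t ∈ Set.Ico (0:ℝ) T, ∀ x,
    deriv (deriv (fun s => u s x)) t - laplacian (u t) x + deriv (fun s => u s x) t
      = |v t x| ^ p) ∧
  (∀ t ∈ Set.Ico (0:ℝ) T, ∀ x,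
    deriv (deriv (fun s => v s x)) t - laplacian (v t) x = |u t x| ^ q)

section WaveEquation

open MeasureTheory Topology

/-- The derivative of `W` in the direction `d`. -/
noncomputable def dirDeriv {F : Type*} [NormedAddCommGroup F] [NormedSpace ℝ F]
    (W : F → ℝ) (d : F) : F → ℝ := fun z => fderiv ℝ W z d

section DirDeriv

variable {F : Type*} [NormedAddCommGroup F] [NormedSpace ℝ F]

lemma ContDiff.dirDeriv {m k : WithTop ℕ∞} {W : F → ℝ} (hW : ContDiff ℝ k W) (hmk : m + 1 ≤ k)
    (d : F) : ContDiff ℝ m (dirDeriv W d) :=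
  (hW.fderiv_right hmk).clm_apply contDiff_const

lemma dirDeriv_mul {f g : F → ℝ} (hf : ContDiff ℝ 1 f) (hg : ContDiff ℝ 1 g) (d z : F) :
    dirDeriv (fun z => f z * g z) d z = dirDeriv f d z * g z + f z * dirDeriv g d z := by
  have h := ((hf.differentiable one_ne_zero z).hasFDerivAt.mul
    (hg.differentiable one_ne_zero z).hasFDerivAt).fderiv
  simp only [dirDeriv]
  change fderiv ℝ (f * g) z d = _
  rw [h]
  simp
  ring

lemma dirDeriv_sub {f g : F → ℝ} (hf : ContDiff ℝ 1 f) (hg : ContDiff ℝ 1 g) (d z : F) :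
    dirDeriv (fun z => f z - g z) d z = dirDeriv f d z - dirDeriv g d z := by
  simp only [dirDeriv]
  rw [fderiv_fun_sub (hf.differentiable one_ne_zero z) (hg.differentiable one_ne_zero z)]
  simp

lemma dirDeriv_add {f g : F → ℝ} (hf : ContDiff ℝ 1 f) (hg : ContDiff ℝ 1 g) (d z : F) :
    dirDeriv (fun z => f z + g z) d z = dirDeriv f d z + dirDeriv g d z := by
  simp only [dirDeriv]
  rw [fderiv_fun_add (hf.differentiable one_ne_zero z) (hg.differentiable one_ne_zero z)]
  simp

lemma dirDeriv_eq_zero_of_isOpen {f : F → ℝ} {U : Set F} (hU : IsOpen U)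
    (hf : ∀ z ∈ U, f z = 0) (d : F) : ∀ z ∈ U, dirDeriv f d z = 0 := by
  intro z hz
  have h : f =ᶠ[𝓝 z] fun _ => (0 : ℝ) := by
    filter_upwards [hU.mem_nhds hz] with y hy using hf y hy
  simp [dirDeriv, h.fderiv_eq]

/-- The directional derivative computed along a line. -/
lemma dirDeriv_eq_of_hasDerivAt {f : F → ℝ} {d z : F} {a : ℝ} (hf : DifferentiableAt ℝ f z)
    (h : HasDerivAt (fun s : ℝ => f (z + s • d)) a 0) : dirDeriv f d z = a :=
  (hf.hasFDerivAt.hasLineDerivAt d).unique h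

variable {E : Type*} [NormedAddCommGroup E] [NormedSpace ℝ E]

lemma hasDerivAt_slice {W : ℝ × E → ℝ} {t : ℝ} {x : E} (hW : DifferentiableAt ℝ W (t, x)) :
    HasDerivAt (fun s => W (s, x)) (dirDeriv W (1, 0) (t, x)) t :=
  hW.hasFDerivAt.comp_hasDerivAt t ((hasDerivAt_id t).prodMk (hasDerivAt_const t x))

lemma fderiv_slice {W : ℝ × E → ℝ} {t : ℝ} {x : E} (hW : DifferentiableAt ℝ W (t, x)) (e : E) :
    fderiv ℝ (fun y => W (t, y)) x e = dirDeriv W (0, e) (t, x) := by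
  have h := (hW.hasFDerivAt.comp x (hasFDerivAt_prodMk_right (𝕜 := ℝ) t x)).fderiv
  change fderiv ℝ (W ∘ fun y => (t, y)) x e = _
  rw [h]
  simp [dirDeriv]

end DirDeriv

/-- The d'Alembertian `∂_t² - Δ` on `ℝ × ℝⁿ`. -/
noncomputable def dAlembert {n : ℕ} (W : ℝ × EuclideanSpace ℝ (Fin n) → ℝ) :
    ℝ × EuclideanSpace ℝ (Fin n) → ℝ := fun z =>
  dirDeriv (dirDeriv W (1, 0)) (1, 0) z
    - ∑ i : Fin n, dirDeriv (dirDeriv W (0, EuclideanSpace.single i 1))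
        (0, EuclideanSpace.single i 1) z

/-- The truncated cone `{(t, x) : 0 < t < T, |x| ≤ R + t}`. -/
def truncCone (n : ℕ) (R T : ℝ) : Set (ℝ × EuclideanSpace ℝ (Fin n)) :=
  {z | 0 < z.1 ∧ z.1 < T ∧ ‖z.2‖ ≤ R + z.1}

/-- The part of the time strip `0 < t < T` outside the cone `|x| ≤ R + t`. -/
def coneExterior (n : ℕ) (R T : ℝ) : Set (ℝ × EuclideanSpace ℝ (Fin n)) :=
  {z | 0 < z.1 ∧ z.1 < T ∧ R + z.1 < ‖z.2‖}

section Cone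

variable {n : ℕ} {R T : ℝ}

lemma deriv_deriv_sub_laplacian_eq_dAlembert {w : ℝ → EuclideanSpace ℝ (Fin n) → ℝ}
    (hw : ContDiff ℝ 2 (fun z : ℝ × EuclideanSpace ℝ (Fin n) => w z.1 z.2)) (t : ℝ)
    (x : EuclideanSpace ℝ (Fin n)) :
    deriv (deriv (fun s => w s x)) t - laplacian (w t) x
      = dAlembert (fun z : ℝ × EuclideanSpace ℝ (Fin n) => w z.1 z.2) (t, x) := by
  set W : ℝ × EuclideanSpace ℝ (Fin n) → ℝ := fun z => w z.1 z.2 with hWdef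
  have hd : Differentiable ℝ W := hw.differentiable two_ne_zero
  have hdd (d) : Differentiable ℝ (dirDeriv W d) :=
    (hw.dirDeriv (m := 1) (by norm_num [one_add_one_eq_two]) d).differentiable one_ne_zero
  have h1 : deriv (fun s => w s x) = fun s => dirDeriv W (1, 0) (s, x) := by
    funext s
    exact (hasDerivAt_slice (hd (s, x))).deriv
  have h2 (e) : (fun y => fderiv ℝ (w t) y e) = fun y => dirDeriv W (0, e) (t, y) := by
    funext y
    exact fderiv_slice (hd (t, y)) e
  rw [h1, (hasDerivAt_slice (hdd _ (t, x))).deriv, laplacian, dAlembert]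
  congr 1
  refine Finset.sum_congr rfl fun i _ => ?_
  rw [h2, fderiv_slice (hdd _ (t, x))]

lemma isOpen_coneExterior : IsOpen (coneExterior n R T) := by
  refine (isOpen_lt continuous_const continuous_fst).inter
    ((isOpen_lt continuous_fst continuous_const).inter
      (isOpen_lt (continuous_const.add continuous_fst) continuous_snd.norm))

lemma measurableSet_truncCone : MeasurableSet (truncCone n R T) := by
  refine (measurableSet_lt measurable_const measurable_fst).inter
    ((measurableSet_lt measurable_fst measurable_const).inter
      (measurableSet_le measurable_snd.norm (measurable_fst.const_add R)))

lemma truncCone_subset :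
    truncCone n R T ⊆ Icc 0 T ×ˢ Metric.closedBall 0 (R + T) := by
  rintro ⟨t, x⟩ ⟨h1, h2, h3⟩
  refine ⟨⟨h1.le, h2.le⟩, ?_⟩
  simp only [mem_closedBall_zero_iff] at *
  linarith

lemma integrableOn_truncCone {h : ℝ × EuclideanSpace ℝ (Fin n) → ℝ} (hc : Continuous h) :
    IntegrableOn h (truncCone n R T) :=
  (hc.continuousOn.integrableOn_compact
    (isCompact_Icc.prod (isCompact_closedBall _ _))).mono_set truncCone_subset

lemma indicator_truncCone_eq {h : ℝ × EuclideanSpace ℝ (Fin n) → ℝ}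
    (h0 : ∀ z ∈ coneExterior n R T, h z = 0) {z : ℝ × EuclideanSpace ℝ (Fin n)}
    (hz : z ∈ Ioo 0 T ×ˢ (univ : Set (EuclideanSpace ℝ (Fin n)))) (hz' : z ∉ truncCone n R T) :
    h z = 0 := by
  refine h0 z ⟨hz.1.1, hz.1.2, ?_⟩
  by_contra hcon
  exact hz' ⟨hz.1.1, hz.1.2, not_lt.1 hcon⟩

lemma truncCone_subset_strip :
    truncCone n R T ⊆ Ioo 0 T ×ˢ (univ : Set (EuclideanSpace ℝ (Fin n))) :=
  fun _ hz => ⟨⟨hz.1, hz.2.1⟩, mem_univ _⟩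

lemma integrable_strip {h : ℝ × EuclideanSpace ℝ (Fin n) → ℝ} (hc : Continuous h)
    (h0 : ∀ z ∈ coneExterior n R T, h z = 0) :
    Integrable h ((volume.restrict (Ioo 0 T)).prod volume) := by
  have h1 : IntegrableOn h (Ioo 0 T ×ˢ univ) := by
    refine (integrableOn_truncCone (R := R) (T := T) hc).of_forall_sdiff_eq_zero
      (measurableSet_Ioo.prod MeasurableSet.univ) ?_
    rintro z ⟨hz, hz'⟩
    exact indicator_truncCone_eq h0 hz hz'
  rw [IntegrableOn, Measure.volume_eq_prod, ← Measure.prod_restrict, Measure.restrict_univ] at h1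
  exact h1

lemma setIntegral_truncCone_eq {h : ℝ × EuclideanSpace ℝ (Fin n) → ℝ}
    (h0 : ∀ z ∈ coneExterior n R T, h z = 0) :
    ∫ z in truncCone n R T, h z = ∫ z, h z ∂((volume.restrict (Ioo 0 T)).prod volume) := by
  have : (volume.restrict (Ioo 0 T)).prod (volume : Measure (EuclideanSpace ℝ (Fin n)))
      = volume.restrict (Ioo 0 T ×ˢ univ) := by
    rw [Measure.volume_eq_prod, ← Measure.prod_restrict, Measure.restrict_univ]
  rw [this]
  exact (setIntegral_eq_of_subset_of_forall_sdiff_eq_zero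
    (measurableSet_Ioo.prod MeasurableSet.univ) truncCone_subset_strip
    fun z hz => indicator_truncCone_eq h0 hz.1 hz.2).symm

/-- A `C¹` function vanishing outside the cone has spatial derivatives of zero integral. -/
lemma integral_dirDeriv_space {h : ℝ × EuclideanSpace ℝ (Fin n) → ℝ} (hh : ContDiff ℝ 1 h)
    (h0 : ∀ z ∈ coneExterior n R T, h z = 0) (e : EuclideanSpace ℝ (Fin n)) :
    ∫ z in truncCone n R T, dirDeriv h (0, e) z = 0 := by
  have hc : Continuous (dirDeriv h (0, e)) :=
    (hh.dirDeriv (m := 0) (by norm_num) (0, e)).continuous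
  have h0' := dirDeriv_eq_zero_of_isOpen isOpen_coneExterior h0 (0, e)
  rw [setIntegral_truncCone_eq h0', integral_prod _ (integrable_strip hc h0')]
  refine setIntegral_eq_zero_of_forall_eq_zero fun t ht => ?_
  set g : EuclideanSpace ℝ (Fin n) → ℝ := fun y => h (t, y) with hg
  have hgC : ContDiff ℝ 1 g := hh.comp (contDiff_const.prodMk contDiff_id)
  have hgs : HasCompactSupport g := by
    refine HasCompactSupport.intro (isCompact_closedBall 0 (R + t)) fun y hy => ?_
    refine h0 _ ⟨ht.1, ht.2, ?_⟩
    simpa using hy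
  have hcong : ∀ y, dirDeriv h (0, e) (t, y) = fderiv ℝ g y e := fun y =>
    (fderiv_slice (hh.differentiable one_ne_zero _) e).symm
  simp_rw [hcong]
  have hgi : Integrable g := hgC.continuous.integrable_of_hasCompactSupport hgs
  have hfi : Integrable (fun y => fderiv ℝ g y e) :=
    ((hgC.continuous_fderiv one_ne_zero).clm_apply
      continuous_const).integrable_of_hasCompactSupport (hgs.fderiv_apply (𝕜 := ℝ) e)
  have := integral_mul_fderiv_eq_neg_fderiv_mul_of_integrable (μ := volume) (𝕜 := ℝ)
    (f := fun _ : EuclideanSpace ℝ (Fin n) => (1 : ℝ)) (g := g) (v := e)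
    (by simp) (by simpa using hfi) (by simpa using hgi)
    (fun x _ => differentiableAt_const _) (fun x _ => hgC.differentiable one_ne_zero x)
  simpa using this

/-- A `C¹` function vanishing outside the cone and at the final time. -/
lemma integral_dirDeriv_time (hT : 0 < T) {h : ℝ × EuclideanSpace ℝ (Fin n) → ℝ}
    (hh : ContDiff ℝ 1 h) (h0 : ∀ z ∈ coneExterior n R T, h z = 0) (hfin : ∀ x, h (T, x) = 0) :
    ∫ z in truncCone n R T, dirDeriv h (1, 0) z = - ∫ x, h (0, x) := by
  have hc : Continuous (dirDeriv h (1, 0)) :=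
    (hh.dirDeriv (m := 0) (by norm_num) (1, 0)).continuous
  have h0' := dirDeriv_eq_zero_of_isOpen isOpen_coneExterior h0 (1, 0)
  rw [setIntegral_truncCone_eq h0', integral_prod_symm _ (integrable_strip hc h0'), ← integral_neg]
  congr 1
  funext x
  rw [← integral_Ioc_eq_integral_Ioo, ← intervalIntegral.integral_of_le hT.le]
  rw [intervalIntegral.integral_eq_sub_of_hasDerivAt (f := fun s => h (s, x))
    (fun t _ => hasDerivAt_slice (hh.differentiable one_ne_zero _))
    ((hc.comp (by fun_prop : Continuous fun t : ℝ => (t, x))).intervalIntegrable _ _), hfin]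
  simp

end Cone

section Green

variable {n : ℕ} {R T : ℝ}

lemma dirDeriv_wronskian {F : Type*} [NormedAddCommGroup F] [NormedSpace ℝ F] {W Φ : F → ℝ}
    (hW : ContDiff ℝ 2 W) (hΦ : ContDiff ℝ 2 Φ) (d z : F) :
    dirDeriv (fun z => dirDeriv W d z * Φ z - W z * dirDeriv Φ d z) d z
      = dirDeriv (dirDeriv W d) d z * Φ z - W z * dirDeriv (dirDeriv Φ d) d z := by
  have h2 : (1 : WithTop ℕ∞) + 1 ≤ 2 := by norm_num [one_add_one_eq_two]
  have hW1 := hW.of_le (one_le_two : (1 : WithTop ℕ∞) ≤ 2)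
  have hΦ1 := hΦ.of_le (one_le_two : (1 : WithTop ℕ∞) ≤ 2)
  have hWd := hW.dirDeriv h2 d
  have hΦd := hΦ.dirDeriv h2 d
  rw [dirDeriv_sub (hWd.mul hΦ1) (hW1.mul hΦd), dirDeriv_mul hWd hΦ1, dirDeriv_mul hW1 hΦd]
  ring

lemma continuous_dAlembert {W : ℝ × EuclideanSpace ℝ (Fin n) → ℝ} (hW : ContDiff ℝ 2 W) :
    Continuous (dAlembert W) := by
  have h (d) : Continuous (dirDeriv (dirDeriv W d) d) :=
    ((hW.dirDeriv (m := 1) (by norm_num [one_add_one_eq_two]) d).dirDeriv (m := 0)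
      (by norm_num) d).continuous
  exact (h _).sub (continuous_finsetSum _ fun i _ => h _)

/-- Green's identity for the wave operator in the truncated cone. -/
lemma integral_dAlembert_mul (hT : 0 < T) {W Φ : ℝ × EuclideanSpace ℝ (Fin n) → ℝ}
    (hW : ContDiff ℝ 2 W) (hΦ : ContDiff ℝ 2 Φ) (h0 : ∀ z ∈ coneExterior n R T, W z = 0)
    (hfin : ∀ x, Φ (T, x) = 0) (hfin' : ∀ x, dirDeriv Φ (1, 0) (T, x) = 0) :
    (∫ z in truncCone n R T, dAlembert W z * Φ z)
      + ∫ x, (dirDeriv W (1, 0) (0, x) * Φ (0, x) - W (0, x) * dirDeriv Φ (1, 0) (0, x))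
      = ∫ z in truncCone n R T, W z * dAlembert Φ z := by
  have h2 : (1 : WithTop ℕ∞) + 1 ≤ 2 := by norm_num [one_add_one_eq_two]
  set g : (ℝ × EuclideanSpace ℝ (Fin n)) → (ℝ × EuclideanSpace ℝ (Fin n)) → ℝ :=
    fun d z => dirDeriv W d z * Φ z - W z * dirDeriv Φ d z with hg
  have hgC (d) : ContDiff ℝ 1 (g d) :=
    ((hW.dirDeriv h2 d).mul (hΦ.of_le one_le_two)).sub
      ((hW.of_le one_le_two).mul (hΦ.dirDeriv h2 d))
  have hg0 (d) : ∀ z ∈ coneExterior n R T, g d z = 0 := fun z hz => by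
    simp [hg, h0 z hz, dirDeriv_eq_zero_of_isOpen isOpen_coneExterior h0 d z hz]
  have htime := integral_dirDeriv_time hT (hgC (1, 0)) (hg0 (1, 0))
    (fun x => by simp [hg, hfin, hfin'])
  have hspace (i : Fin n) := integral_dirDeriv_space (hgC (0, EuclideanSpace.single i 1))
    (hg0 (0, EuclideanSpace.single i 1)) (EuclideanSpace.single i 1)
  have hint (d) : IntegrableOn (dirDeriv (g d) d) (truncCone n R T) :=
    integrableOn_truncCone ((hgC d).dirDeriv (m := 0) (by norm_num) d).continuous
  have hid : ∀ z, dAlembert W z * Φ z - W z * dAlembert Φ z = dirDeriv (g (1, 0)) (1, 0) z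
      - ∑ i : Fin n, dirDeriv (g (0, EuclideanSpace.single i 1))
        (0, EuclideanSpace.single i 1) z := by
    intro z
    simp only [hg, dirDeriv_wronskian hW hΦ, dAlembert, Finset.sum_sub_distrib,
      ← Finset.sum_mul, ← Finset.mul_sum]
    ring
  have hA : IntegrableOn (fun z => dAlembert W z * Φ z) (truncCone n R T) :=
    integrableOn_truncCone ((continuous_dAlembert hW).mul hΦ.continuous)
  have hB : IntegrableOn (fun z => W z * dAlembert Φ z) (truncCone n R T) :=
    integrableOn_truncCone (hW.continuous.mul (continuous_dAlembert hΦ))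
  have key : (∫ z in truncCone n R T, dAlembert W z * Φ z)
      - ∫ z in truncCone n R T, W z * dAlembert Φ z = - ∫ x, g (1, 0) (0, x) := by
    rw [← integral_sub hA hB]
    simp_rw [hid]
    rw [integral_sub (hint _) (integrable_finsetSum _ fun i _ => hint _),
      integral_finsetSum _ fun i _ => hint _, htime]
    simp [hspace]
  simp only [hg] at key
  linarith

lemma integral_dirDeriv_time_mul (hT : 0 < T) {W Φ : ℝ × EuclideanSpace ℝ (Fin n) → ℝ}
    (hW : ContDiff ℝ 1 W) (hΦ : ContDiff ℝ 1 Φ) (h0 : ∀ z ∈ coneExterior n R T, W z = 0)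
    (hfin : ∀ x, Φ (T, x) = 0) :
    (∫ z in truncCone n R T, dirDeriv W (1, 0) z * Φ z) + ∫ x, W (0, x) * Φ (0, x)
      = - ∫ z in truncCone n R T, W z * dirDeriv Φ (1, 0) z := by
  have htime := integral_dirDeriv_time (R := R) hT (hW.mul hΦ) (fun z hz => by simp [h0 z hz])
    (fun x => by simp [hfin])
  simp_rw [dirDeriv_mul hW hΦ] at htime
  have hc {f : ℝ × EuclideanSpace ℝ (Fin n) → ℝ} (hf : ContDiff ℝ 1 f) :
      Continuous (dirDeriv f (1, 0)) := (hf.dirDeriv (m := 0) (by norm_num) (1, 0)).continuous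
  have hA : IntegrableOn (fun z => dirDeriv W (1, 0) z * Φ z) (truncCone n R T) :=
    integrableOn_truncCone ((hc hW).mul hΦ.continuous)
  have hB : IntegrableOn (fun z => W z * dirDeriv Φ (1, 0) z) (truncCone n R T) :=
    integrableOn_truncCone (hW.continuous.mul (hc hΦ))
  rw [integral_add hA hB] at htime
  linarith

end Green

section TimeCutoff

variable {n : ℕ} {T : ℝ} {η : ℝ → ℝ}

lemma dirDeriv_timeRescale (hη : Differentiable ℝ η) :
    dirDeriv (fun z : ℝ × EuclideanSpace ℝ (Fin n) => η (z.1 / T)) (1, 0)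
      = fun z => deriv η (z.1 / T) / T := by
  funext ⟨t, x⟩
  have hd : DifferentiableAt ℝ (fun z : ℝ × EuclideanSpace ℝ (Fin n) => η (z.1 / T)) (t, x) :=
    (hη _).comp (t, x) (by fun_prop)
  refine (hasDerivAt_slice hd).unique ?_
  have := (hη (t / T)).hasDerivAt.comp t ((hasDerivAt_id t).div_const T)
  simpa [div_eq_mul_inv, Function.comp_def] using this

lemma dirDeriv_timeRescale_space (hη : Differentiable ℝ η) (e : EuclideanSpace ℝ (Fin n)) :
    dirDeriv (fun z : ℝ × EuclideanSpace ℝ (Fin n) => η (z.1 / T)) (0, e) = fun _ => 0 := by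
  funext ⟨t, x⟩
  have hd : DifferentiableAt ℝ (fun z : ℝ × EuclideanSpace ℝ (Fin n) => η (z.1 / T)) (t, x) :=
    (hη _).comp (t, x) (by fun_prop)
  rw [← fderiv_slice hd]
  simp

lemma dirDeriv_mul_timeRescale (hη : ContDiff ℝ 2 η)
    {Ψ : ℝ × EuclideanSpace ℝ (Fin n) → ℝ} (hΨ : ContDiff ℝ 2 Ψ)
    (z : ℝ × EuclideanSpace ℝ (Fin n)) :
    dirDeriv (fun z => Ψ z * η (z.1 / T)) (1, 0) z
      = dirDeriv Ψ (1, 0) z * η (z.1 / T) + Ψ z * (deriv η (z.1 / T) / T) := by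
  have hΘ : ContDiff ℝ 1 (fun z : ℝ × EuclideanSpace ℝ (Fin n) => η (z.1 / T)) :=
    (hη.of_le one_le_two).comp (contDiff_fst.div_const T)
  rw [dirDeriv_mul (hΨ.of_le one_le_two) hΘ, dirDeriv_timeRescale (hη.differentiable two_ne_zero)]

lemma dAlembert_mul_timeRescale (hη : ContDiff ℝ 2 η)
    {Ψ : ℝ × EuclideanSpace ℝ (Fin n) → ℝ} (hΨ : ContDiff ℝ 2 Ψ)
    (z : ℝ × EuclideanSpace ℝ (Fin n)) :
    dAlembert (fun z => Ψ z * η (z.1 / T)) z = dAlembert Ψ z * η (z.1 / T)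
      + (2 * dirDeriv Ψ (1, 0) z * (deriv η (z.1 / T) / T)
        + Ψ z * (deriv (deriv η) (z.1 / T) / T ^ 2)) := by
  have h2 : (1 : WithTop ℕ∞) + 1 ≤ 2 := by norm_num [one_add_one_eq_two]
  have hη1 : ContDiff ℝ 1 (deriv η) := by
    have : ContDiff ℝ (1 + 1) η := by simpa [one_add_one_eq_two] using hη
    exact (contDiff_succ_iff_deriv.1 this).2.2
  have hηd := hη.differentiable two_ne_zero
  have hηd1 := hη1.differentiable one_ne_zero
  have hΨ1 := hΨ.of_le (one_le_two : (1 : WithTop ℕ∞) ≤ 2)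
  have hΘ : ContDiff ℝ 1 (fun z : ℝ × EuclideanSpace ℝ (Fin n) => η (z.1 / T)) :=
    (hη.of_le one_le_two).comp (contDiff_fst.div_const T)
  have hΘ1 : ContDiff ℝ 1 (fun z : ℝ × EuclideanSpace ℝ (Fin n) => deriv η (z.1 / T) / T) :=
    (hη1.comp (contDiff_fst.div_const T)).div_const T
  have hΘ2 : dirDeriv (fun z : ℝ × EuclideanSpace ℝ (Fin n) => deriv η (z.1 / T) / T) (1, 0)
      = fun z => deriv (deriv η) (z.1 / T) / T ^ 2 := by
    funext z
    have h := congrFun (dirDeriv_timeRescale (n := n) (T := T) hηd1) z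
    have hc : ContDiff ℝ 1 (fun z : ℝ × EuclideanSpace ℝ (Fin n) => deriv η (z.1 / T)) :=
      hη1.comp (contDiff_fst.div_const T)
    have hm := dirDeriv_mul hc (contDiff_const (c := T⁻¹)) (1, 0) z
    rw [h] at hm
    simp only [div_eq_mul_inv] at hm ⊢
    rw [hm]
    simp [dirDeriv]
    ring
  have htime : dirDeriv (dirDeriv (fun z => Ψ z * η (z.1 / T)) (1, 0)) (1, 0) z
      = dirDeriv (dirDeriv Ψ (1, 0)) (1, 0) z * η (z.1 / T)
        + (2 * dirDeriv Ψ (1, 0) z * (deriv η (z.1 / T) / T)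
          + Ψ z * (deriv (deriv η) (z.1 / T) / T ^ 2)) := by
    have : dirDeriv (fun z => Ψ z * η (z.1 / T)) (1, 0)
      = fun z => dirDeriv Ψ (1, 0) z * η (z.1 / T) + Ψ z * (deriv η (z.1 / T) / T) :=
      funext fun z => dirDeriv_mul_timeRescale hη hΨ z
    rw [this, dirDeriv_add ((hΨ.dirDeriv h2 _).mul hΘ) (hΨ1.mul hΘ1),
      dirDeriv_mul (hΨ.dirDeriv h2 _) hΘ, dirDeriv_mul hΨ1 hΘ1, hΘ2, dirDeriv_timeRescale hηd]
    ring
  have hspace (e : EuclideanSpace ℝ (Fin n)) :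
      dirDeriv (dirDeriv (fun z => Ψ z * η (z.1 / T)) (0, e)) (0, e) z
        = dirDeriv (dirDeriv Ψ (0, e)) (0, e) z * η (z.1 / T) := by
    have : dirDeriv (fun z => Ψ z * η (z.1 / T)) (0, e)
        = fun z => dirDeriv Ψ (0, e) z * η (z.1 / T) := by
      funext z
      rw [dirDeriv_mul hΨ1 hΘ, dirDeriv_timeRescale_space hηd]
      simp
    rw [this, dirDeriv_mul (hΨ.dirDeriv h2 _) hΘ, dirDeriv_timeRescale_space hηd]
    simp
  simp only [dAlembert, htime, hspace, ← Finset.sum_mul]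
  ring

end TimeCutoff

/-- `η` is a `C²` cutoff in time, equal to `1` on `(-∞, 1/2]` and to `0` on `[1, ∞)`, whose first two
derivatives are bounded by `C * η ^ a`. -/
structure IsTimeCutoff (a C : ℝ) (η : ℝ → ℝ) : Prop where
  contDiff : ContDiff ℝ 2 η
  nonneg : ∀ s, 0 ≤ η s
  le_one : ∀ s, η s ≤ 1
  eq_one : ∀ s ≤ 1 / 2, η s = 1
  eq_zero : ∀ s, 1 ≤ s → η s = 0
  const_pos : 0 < C
  abs_deriv_le : ∀ s, |deriv η s| ≤ C * η s ^ a
  abs_deriv_deriv_le : ∀ s, |deriv (deriv η) s| ≤ C * η s ^ a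

lemma exists_isTimeCutoff {a : ℝ} (ha0 : 0 < a) (ha1 : a < 1) :
    ∃ C η, IsTimeCutoff a C η := by
  obtain ⟨m, hm⟩ := exists_nat_ge (2 * a / (1 - a))
  have hma : a * (m + 2) ≤ m := by
    rw [div_le_iff₀ (by linarith)] at hm
    linarith
  set f : ℝ → ℝ := fun s => smoothTransition (2 - 2 * s) with hf
  have hfC : ContDiff ℝ 2 f := smoothTransition.contDiff.comp (by fun_prop)
  have hfC' : ContDiff ℝ (1 + 1) f := by simpa [one_add_one_eq_two] using hfC
  have hf1C : ContDiff ℝ 1 (deriv f) := (contDiff_succ_iff_deriv.1 hfC').2.2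
  have hf0 (s) : 0 ≤ f s := smoothTransition.nonneg _
  have hf1 (s) : f s ≤ 1 := smoothTransition.le_one _
  have hsupp : HasCompactSupport (deriv f) := by
    refine HasCompactSupport.intro (isCompact_Icc (a := (1 : ℝ) / 2) (b := 1)) fun s hs => ?_
    rcases lt_or_ge s (1 / 2) with h | h
    · have : f =ᶠ[𝓝 s] fun _ => (1 : ℝ) := by
        filter_upwards [Iio_mem_nhds h] with y hy
        exact smoothTransition.one_of_one_le (by simp only [mem_Iio] at hy; linarith)
      rw [this.deriv_eq]; simp
    · have h' : 1 < s := by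
        by_contra hcon
        exact hs ⟨h, not_lt.1 hcon⟩
      have : f =ᶠ[𝓝 s] fun _ => (0 : ℝ) := by
        filter_upwards [Ioi_mem_nhds h'] with y hy
        exact smoothTransition.zero_of_nonpos (by simp only [mem_Ioi] at hy; linarith)
      rw [this.deriv_eq]; simp
  obtain ⟨M₁, hM₁⟩ := hf1C.continuous.bounded_above_of_compact_support hsupp
  obtain ⟨M₂, hM₂⟩ := (hf1C.continuous_deriv le_rfl).bounded_above_of_compact_support hsupp.deriv
  simp only [Real.norm_eq_abs] at hM₁ hM₂
  have hM₁0 : 0 ≤ M₁ := (abs_nonneg _).trans (hM₁ 0)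
  have hM₂0 : 0 ≤ M₂ := (abs_nonneg _).trans (hM₂ 0)
  have hd (s) : HasDerivAt f (deriv f s) s := (hfC.differentiable two_ne_zero s).hasDerivAt
  have hdd (s) : HasDerivAt (deriv f) (deriv (deriv f) s) s :=
    (hf1C.differentiable one_ne_zero s).hasDerivAt
  have hη1 : deriv (fun s => f s ^ (m + 2)) = fun s => (m + 2) * f s ^ (m + 1) * deriv f s := by
    funext s
    simpa using ((hd s).fun_pow (m + 2)).deriv
  have hη2 (s) : deriv (deriv (fun s => f s ^ (m + 2))) s
      = (m + 2) * ((m + 1) * f s ^ m * deriv f s ^ 2 + f s ^ (m + 1) * deriv (deriv f) s) := by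
    rw [hη1]
    have := ((((hd s).fun_pow (m + 1)).const_mul ((m : ℝ) + 2)).mul (hdd s)).deriv
    refine Eq.trans this ?_
    push_cast
    ring_nf
  have hpow (s) : f s ^ m ≤ (f s ^ (m + 2)) ^ a := by
    rw [← Real.rpow_natCast, ← Real.rpow_natCast, ← Real.rpow_mul (hf0 s)]
    refine Real.rpow_le_rpow_of_exponent_ge' (hf0 s) (hf1 s) (by positivity) ?_
    push_cast
    linarith
  have hpow1 (s) : f s ^ (m + 1) ≤ (f s ^ (m + 2)) ^ a :=
    (pow_le_pow_of_le_one (hf0 s) (hf1 s) (Nat.le_succ m)).trans (hpow s)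
  refine ⟨(m + 2) * (M₁ + (m + 1) * M₁ ^ 2 + M₂) + 1, fun s => f s ^ (m + 2), hfC.pow _,
    fun s => pow_nonneg (hf0 s) _, fun s => pow_le_one₀ (hf0 s) (hf1 s), fun s hs => ?_,
    fun s hs => ?_, by positivity, fun s => ?_, fun s => ?_⟩
  · have : f s = 1 := smoothTransition.one_of_one_le (by linarith)
    simp [this]
  · have : f s = 0 := smoothTransition.zero_of_nonpos (by linarith)
    simp [this]
  · rw [hη1]
    simp only
    set P := (f s ^ (m + 2)) ^ a
    have hP : 0 ≤ P := Real.rpow_nonneg (pow_nonneg (hf0 s) _) _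
    rw [abs_mul, abs_mul, abs_of_nonneg (by positivity : (0 : ℝ) ≤ m + 2),
      abs_of_nonneg (pow_nonneg (hf0 s) _)]
    calc (m + 2) * f s ^ (m + 1) * |deriv f s| ≤ (m + 2) * P * M₁ := by
          gcongr
          · exact hpow1 s
          · exact hM₁ s
      _ ≤ _ := by
          have : 0 ≤ (m + 2) * ((m + 1) * M₁ ^ 2 + M₂) * P + P := by positivity
          linarith
  · rw [hη2]
    set P := (f s ^ (m + 2)) ^ a
    have hP : 0 ≤ P := Real.rpow_nonneg (pow_nonneg (hf0 s) _) _
    have hfm : 0 ≤ f s ^ m := pow_nonneg (hf0 s) _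
    have hfm1 : 0 ≤ f s ^ (m + 1) := pow_nonneg (hf0 s) _
    rw [abs_mul, abs_of_nonneg (by positivity : (0 : ℝ) ≤ m + 2)]
    have h1 : |(m + 1) * f s ^ m * deriv f s ^ 2| ≤ (m + 1) * P * M₁ ^ 2 := by
      rw [abs_mul, abs_mul, abs_of_nonneg (by positivity : (0 : ℝ) ≤ m + 1), abs_of_nonneg hfm,
        abs_pow]
      gcongr
      · exact hpow s
      · exact hM₁ s
    have h2 : |f s ^ (m + 1) * deriv (deriv f) s| ≤ P * M₂ := by
      rw [abs_mul, abs_of_nonneg hfm1]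
      gcongr
      · exact hpow1 s
      · exact hM₂ s
    calc _ ≤ (m + 2) * ((m + 1) * P * M₁ ^ 2 + P * M₂) := by
          gcongr
          exact (abs_add_le _ _).trans (add_le_add h1 h2)
      _ ≤ _ := by
          have : 0 ≤ (m + 2) * M₁ * P + P := by positivity
          linarith

namespace IsTimeCutoff

variable {a C : ℝ} {η : ℝ → ℝ}

lemma mono {b : ℝ} (h : IsTimeCutoff a C η) (hb : 0 ≤ b) (hba : b ≤ a) : IsTimeCutoff b C η := by
  have hpow (s) : C * η s ^ a ≤ C * η s ^ b :=
    mul_le_mul_of_nonneg_left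
      (Real.rpow_le_rpow_of_exponent_ge' (h.nonneg s) (h.le_one s) hb hba) h.const_pos.le
  exact { h with
    abs_deriv_le := fun s => (h.abs_deriv_le s).trans (hpow s)
    abs_deriv_deriv_le := fun s => (h.abs_deriv_deriv_le s).trans (hpow s) }

lemma contDiff_deriv (h : IsTimeCutoff a C η) : ContDiff ℝ 1 (deriv η) := by
  have : ContDiff ℝ (1 + 1) η := by simpa [one_add_one_eq_two] using h.contDiff
  exact (contDiff_succ_iff_deriv.1 this).2.2

lemma continuous_deriv (h : IsTimeCutoff a C η) : Continuous (deriv η) :=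
  h.contDiff_deriv.continuous

lemma continuous_deriv_deriv (h : IsTimeCutoff a C η) : Continuous (deriv (deriv η)) :=
  h.contDiff_deriv.continuous_deriv le_rfl

lemma deriv_eq_zero (h : IsTimeCutoff a C η) : ∀ s ≤ 1 / 2, deriv η s = 0 := by
  have hs : EqOn (deriv η) (fun _ => 0) (Iio (1 / 2)) := fun s hs => by
    have : η =ᶠ[𝓝 s] fun _ => (1 : ℝ) := by
      filter_upwards [Iio_mem_nhds hs] with y hy using h.eq_one y (le_of_lt hy)
    rw [this.deriv_eq]; simp
  have := hs.closure h.continuous_deriv continuous_const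
  rwa [closure_Iio] at this

lemma deriv_deriv_eq_zero (h : IsTimeCutoff a C η) : ∀ s ≤ 1 / 2, deriv (deriv η) s = 0 := by
  have hs : EqOn (deriv (deriv η)) (fun _ => 0) (Iio (1 / 2)) := fun s hs => by
    have : deriv η =ᶠ[𝓝 s] fun _ => (0 : ℝ) := by
      filter_upwards [Iio_mem_nhds hs] with y hy using h.deriv_eq_zero y (le_of_lt hy)
    rw [this.deriv_eq]; simp
  have := hs.closure h.continuous_deriv_deriv continuous_const
  rwa [closure_Iio] at this

lemma deriv_one (h : IsTimeCutoff a C η) (ha : 0 < a) : deriv η 1 = 0 := by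
  have := h.abs_deriv_le 1
  rw [h.eq_zero 1 le_rfl, Real.zero_rpow ha.ne', mul_zero] at this
  exact abs_nonpos_iff.1 this

end IsTimeCutoff

section Kernel

variable {n : ℕ}

/-- A smooth function on `ℝ` equal to `s ^ a` for `s ≥ 1/2`. -/
lemma exists_contDiff_eq_rpow (a : ℝ) :
    ∃ h : ℝ → ℝ, ContDiff ℝ 2 h ∧ ∀ s, 1 / 2 < s → h s = s ^ a := by
  refine ⟨fun s => smoothTransition (4 * s - 1) * s ^ a, ?_, fun s hs => ?_⟩
  · rw [contDiff_iff_contDiffAt]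
    intro s
    rcases eq_or_ne s 0 with rfl | hs
    · have : (fun s : ℝ => smoothTransition (4 * s - 1) * s ^ a) =ᶠ[𝓝 0] fun _ => (0 : ℝ) := by
        filter_upwards [Iio_mem_nhds (show (0 : ℝ) < 1 / 4 by norm_num)] with y hy
        rw [smoothTransition.zero_of_nonpos (by simp only [mem_Iio] at hy; linarith), zero_mul]
      exact contDiffAt_const.congr_of_eventuallyEq this
    · exact (smoothTransition.contDiffAt.comp s (by fun_prop)).mul
        (Real.contDiffAt_rpow_const_of_ne hs)
  · simp only
    rw [smoothTransition.one_of_one_le (by linarith), one_mul]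

lemma deriv_of_eq_rpow {a : ℝ} {h : ℝ → ℝ} (hh : ∀ s, 1 / 2 < s → h s = s ^ a) :
    ∀ s, 1 / 2 < s → deriv h s = a * s ^ (a - 1) := by
  intro s hs
  have : h =ᶠ[𝓝 s] fun s => s ^ a := by
    filter_upwards [Ioi_mem_nhds hs] with y hy using hh y hy
  rw [this.deriv_eq, Real.deriv_rpow_const]

lemma deriv_deriv_of_eq_rpow {a : ℝ} {h : ℝ → ℝ} (hh : ∀ s, 1 / 2 < s → h s = s ^ a) :
    ∀ s, 1 / 2 < s → deriv (deriv h) s = a * ((a - 1) * s ^ (a - 2)) := by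
  intro s hs
  have : deriv h =ᶠ[𝓝 s] fun s => a * s ^ (a - 1) := by
    filter_upwards [Ioi_mem_nhds hs] with y hy using deriv_of_eq_rpow hh y hy
  have hs0 : s ≠ 0 := by linarith
  rw [this.deriv_eq, ((Real.hasDerivAt_rpow_const (p := a - 1) (Or.inl hs0)).const_mul a).deriv]
  ring_nf

/-- The d'Alembertian of `τ h(τ² - |x|²)` with `τ = t + b`. -/
lemma dAlembert_lorentz {b : ℝ} {h : ℝ → ℝ} (hh : ContDiff ℝ 2 h)
    (z : ℝ × EuclideanSpace ℝ (Fin n)) :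
    dirDeriv (fun z : ℝ × EuclideanSpace ℝ (Fin n) =>
        (z.1 + b) * h ((z.1 + b) ^ 2 - ‖z.2‖ ^ 2)) (1, 0) z
      = h ((z.1 + b) ^ 2 - ‖z.2‖ ^ 2)
        + 2 * (z.1 + b) ^ 2 * deriv h ((z.1 + b) ^ 2 - ‖z.2‖ ^ 2) ∧
    dAlembert (fun z : ℝ × EuclideanSpace ℝ (Fin n) =>
        (z.1 + b) * h ((z.1 + b) ^ 2 - ‖z.2‖ ^ 2)) z
      = (z.1 + b) * ((6 + 2 * n) * deriv h ((z.1 + b) ^ 2 - ‖z.2‖ ^ 2)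
        + 4 * ((z.1 + b) ^ 2 - ‖z.2‖ ^ 2) * deriv (deriv h) ((z.1 + b) ^ 2 - ‖z.2‖ ^ 2)) := by
  have hh' : ContDiff ℝ (1 + 1) h := by simpa [one_add_one_eq_two] using hh
  have hh1 : ContDiff ℝ 1 (deriv h) := (contDiff_succ_iff_deriv.1 hh').2.2
  have hσ : ContDiff ℝ 2 (fun z : ℝ × EuclideanSpace ℝ (Fin n) => (z.1 + b) ^ 2 - ‖z.2‖ ^ 2) :=
    ((contDiff_fst.add contDiff_const).pow 2).sub (contDiff_snd.norm_sq ℝ)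
  have hτ : ContDiff ℝ 2 (fun z : ℝ × EuclideanSpace ℝ (Fin n) => z.1 + b) :=
    contDiff_fst.add contDiff_const
  have hσt (z : ℝ × EuclideanSpace ℝ (Fin n)) : HasDerivAt (fun s : ℝ =>
      ((z + s • ((1 : ℝ), (0 : EuclideanSpace ℝ (Fin n)))).1 + b) ^ 2
        - ‖(z + s • ((1 : ℝ), (0 : EuclideanSpace ℝ (Fin n)))).2‖ ^ 2) (2 * (z.1 + b)) 0 := by
    have : HasDerivAt (fun s : ℝ => (z.1 + s + b) ^ 2 - ‖z.2‖ ^ 2) (2 * (z.1 + b)) 0 := by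
      simpa using ((((hasDerivAt_id (0 : ℝ)).const_add z.1).add_const b).fun_pow 2).sub_const (‖z.2‖ ^ 2)
    simpa using this
  have hσx (i : Fin n) (z : ℝ × EuclideanSpace ℝ (Fin n)) : HasDerivAt (fun s : ℝ =>
      ((z + s • ((0 : ℝ), EuclideanSpace.single i (1 : ℝ))).1 + b) ^ 2
        - ‖(z + s • ((0 : ℝ), EuclideanSpace.single i (1 : ℝ))).2‖ ^ 2) (-2 * z.2 i) 0 := by
    have : HasDerivAt (fun s : ℝ => (z.1 + b) ^ 2 - (‖z.2‖ ^ 2 + 2 * (s * z.2 i) + s ^ 2))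
        (-2 * z.2 i) 0 := by
      have h1 := ((((hasDerivAt_id (0 : ℝ)).mul_const (z.2 i)).const_mul 2).const_add
        (‖z.2‖ ^ 2)).add ((hasDerivAt_id (0 : ℝ)).fun_pow 2)
      simpa using h1.const_sub ((z.1 + b) ^ 2)
    convert this using 2 with s
    simp [norm_add_sq_real, inner_smul_right, norm_smul, EuclideanSpace.inner_single_right]
  have hcomp {g : ℝ → ℝ} (hg : ContDiff ℝ 1 g) {d z : ℝ × EuclideanSpace ℝ (Fin n)} {c : ℝ}
      (hc : HasDerivAt (fun s : ℝ => ((z + s • d).1 + b) ^ 2 - ‖(z + s • d).2‖ ^ 2) c 0) :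
      dirDeriv (fun z : ℝ × EuclideanSpace ℝ (Fin n) => g ((z.1 + b) ^ 2 - ‖z.2‖ ^ 2)) d z
        = deriv g ((z.1 + b) ^ 2 - ‖z.2‖ ^ 2) * c := by
    refine dirDeriv_eq_of_hasDerivAt
      ((hg.comp (hσ.of_le one_le_two)).differentiable one_ne_zero z) ?_
    have hz : z + (0 : ℝ) • d = z := by simp
    have := (hg.differentiable one_ne_zero _).hasDerivAt.comp (0 : ℝ) hc
    simpa only [hz, Function.comp_def] using this
  have hgC {g : ℝ → ℝ} (hg : ContDiff ℝ 1 g) :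
      ContDiff ℝ 1 (fun z : ℝ × EuclideanSpace ℝ (Fin n) => g ((z.1 + b) ^ 2 - ‖z.2‖ ^ 2)) :=
    hg.comp (hσ.of_le one_le_two)
  have hτ1 : ContDiff ℝ 1 (fun z : ℝ × EuclideanSpace ℝ (Fin n) => z.1 + b) :=
    hτ.of_le one_le_two
  have hτt (z : ℝ × EuclideanSpace ℝ (Fin n)) :
      dirDeriv (fun z : ℝ × EuclideanSpace ℝ (Fin n) => z.1 + b) (1, 0) z = 1 := by
    refine dirDeriv_eq_of_hasDerivAt (hτ1.differentiable one_ne_zero z) ?_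
    simpa using ((hasDerivAt_id (0 : ℝ)).const_add z.1).add_const b
  have hτx (e : EuclideanSpace ℝ (Fin n)) (z : ℝ × EuclideanSpace ℝ (Fin n)) :
      dirDeriv (fun z : ℝ × EuclideanSpace ℝ (Fin n) => z.1 + b) (0, e) z = 0 := by
    refine dirDeriv_eq_of_hasDerivAt (hτ1.differentiable one_ne_zero z) ?_
    simpa using hasDerivAt_const (0 : ℝ) (z.1 + b)
  have hxi (i : Fin n) (z : ℝ × EuclideanSpace ℝ (Fin n)) :
      dirDeriv (fun z : ℝ × EuclideanSpace ℝ (Fin n) => -2 * z.2 i)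
        (0, EuclideanSpace.single i 1) z = -2 := by
    refine dirDeriv_eq_of_hasDerivAt (by fun_prop) ?_
    have := ((hasDerivAt_id (0 : ℝ)).const_add (z.2 i)).const_mul (-2)
    simpa using this
  have hh0 : ContDiff ℝ 1 h := hh.of_le one_le_two
  have ht : dirDeriv (fun z : ℝ × EuclideanSpace ℝ (Fin n) =>
        (z.1 + b) * h ((z.1 + b) ^ 2 - ‖z.2‖ ^ 2)) (1, 0)
      = fun z => h ((z.1 + b) ^ 2 - ‖z.2‖ ^ 2)
        + 2 * (z.1 + b) ^ 2 * deriv h ((z.1 + b) ^ 2 - ‖z.2‖ ^ 2) := by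
    funext z
    rw [dirDeriv_mul hτ1 (hgC hh0), hτt, hcomp hh0 (hσt z)]
    ring
  have hx (i : Fin n) : dirDeriv (fun z : ℝ × EuclideanSpace ℝ (Fin n) =>
        (z.1 + b) * h ((z.1 + b) ^ 2 - ‖z.2‖ ^ 2)) (0, EuclideanSpace.single i 1)
      = fun z => (z.1 + b) * (deriv h ((z.1 + b) ^ 2 - ‖z.2‖ ^ 2) * (-2 * z.2 i)) := by
    funext z
    rw [dirDeriv_mul hτ1 (hgC hh0), hτx, hcomp hh0 (hσx i z)]
    ring
  refine ⟨congrFun ht z, ?_⟩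
  have htt : dirDeriv (dirDeriv (fun z : ℝ × EuclideanSpace ℝ (Fin n) =>
        (z.1 + b) * h ((z.1 + b) ^ 2 - ‖z.2‖ ^ 2)) (1, 0)) (1, 0) z
      = 6 * (z.1 + b) * deriv h ((z.1 + b) ^ 2 - ‖z.2‖ ^ 2)
        + 4 * (z.1 + b) ^ 3 * deriv (deriv h) ((z.1 + b) ^ 2 - ‖z.2‖ ^ 2) := by
    have hsq : ContDiff ℝ 1 (fun z : ℝ × EuclideanSpace ℝ (Fin n) => 2 * (z.1 + b) ^ 2) :=
      contDiff_const.mul (hτ1.pow 2)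
    have hsqt : dirDeriv (fun z : ℝ × EuclideanSpace ℝ (Fin n) => 2 * (z.1 + b) ^ 2) (1, 0) z
        = 4 * (z.1 + b) := by
      refine dirDeriv_eq_of_hasDerivAt (hsq.differentiable one_ne_zero z) ?_
      have := ((((hasDerivAt_id (0 : ℝ)).const_add z.1).add_const b).fun_pow 2).const_mul 2
      refine HasDerivAt.congr_deriv (by simpa using this) ?_
      ring
    rw [ht, dirDeriv_add (hgC hh0) (hsq.mul (hgC hh1)), dirDeriv_mul hsq (hgC hh1),
      hcomp hh0 (hσt z), hcomp hh1 (hσt z), hsqt]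
    ring
  have hxx (i : Fin n) : dirDeriv (dirDeriv (fun z : ℝ × EuclideanSpace ℝ (Fin n) =>
        (z.1 + b) * h ((z.1 + b) ^ 2 - ‖z.2‖ ^ 2)) (0, EuclideanSpace.single i 1))
        (0, EuclideanSpace.single i 1) z
      = -2 * (z.1 + b) * deriv h ((z.1 + b) ^ 2 - ‖z.2‖ ^ 2)
        + 4 * (z.1 + b) * deriv (deriv h) ((z.1 + b) ^ 2 - ‖z.2‖ ^ 2) * z.2 i ^ 2 := by
    have hxC : ContDiff ℝ 1 (fun z : ℝ × EuclideanSpace ℝ (Fin n) => -2 * z.2 i) := by fun_prop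
    rw [hx, dirDeriv_mul hτ1 ((hgC hh1).mul hxC), dirDeriv_mul (hgC hh1) hxC, hτx, hxi,
      hcomp hh1 (hσx i z)]
    ring
  simp only [dAlembert]
  rw [htt]
  simp only [hxx, Finset.sum_add_distrib, ← Finset.mul_sum, Finset.sum_const, Finset.card_univ,
    Fintype.card_fin, nsmul_eq_mul]
  rw [← EuclideanSpace.real_norm_sq_eq]
  ring

end Kernel

section KernelEstimates

variable {n : ℕ}

/-- A positive solution of the wave equation in the cone, concentrated near its boundary: the time
translate of `t (t² - |x|²)^(-(n+1)/2)`. -/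
lemma exists_waveKernel (n : ℕ) {R : ℝ} (hR : 0 < R) :
    ∃ Ψ : ℝ × EuclideanSpace ℝ (Fin n) → ℝ, ContDiff ℝ 2 Ψ ∧
      ∀ z, 0 ≤ z.1 → ‖z.2‖ ≤ R + z.1 → dAlembert Ψ z = 0 ∧ 0 < Ψ z ∧ dirDeriv Ψ (1, 0) z ≤ 0 ∧
        |dirDeriv Ψ (1, 0) z| ≤ (n + 1) * Ψ z ∧
        Ψ z ≤ (z.1 + (R + 1)) ^ (-(((n : ℝ) - 1) / 2))
          * (z.1 + (R + 1) - ‖z.2‖) ^ (-(((n : ℝ) + 1) / 2)) := by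
  set a : ℝ := -(((n : ℝ) + 1) / 2) with ha
  obtain ⟨h, hC, hh⟩ := exists_contDiff_eq_rpow a
  refine ⟨fun z => (z.1 + (R + 1)) * h ((z.1 + (R + 1)) ^ 2 - ‖z.2‖ ^ 2), ?_, fun z hz0 hzR => ?_⟩
  · exact (contDiff_fst.add contDiff_const).mul (hC.comp
      (((contDiff_fst.add contDiff_const).pow 2).sub (contDiff_snd.norm_sq ℝ)))
  obtain ⟨hd, hbox⟩ := dAlembert_lorentz (n := n) (b := R + 1) hC z
  rw [hd, hbox]
  simp only
  set τ := z.1 + (R + 1) with hτ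
  set r := ‖z.2‖ with hr
  have hr0 : 0 ≤ r := norm_nonneg _
  have hτr : 1 ≤ τ - r := by linarith
  have hτ1 : 1 ≤ τ := by linarith
  set σ := τ ^ 2 - r ^ 2 with hσ
  have hσf : σ = (τ - r) * (τ + r) := by rw [hσ]; ring
  have hστ : τ * (τ - r) ≤ σ := by rw [hσf]; nlinarith
  have hστ' : τ ≤ σ := by nlinarith
  have hσ2 : 1 / 2 < σ := by linarith
  have hσ0 : 0 < σ := by linarith
  rw [hh σ hσ2, deriv_of_eq_rpow hh σ hσ2, deriv_deriv_of_eq_rpow hh σ hσ2]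
  have e1 : σ ^ a = σ ^ (a - 1) * σ := by
    rw [← Real.rpow_add_one hσ0.ne']; ring_nf
  have e2 : σ ^ (a - 1) = σ ^ (a - 2) * σ := by
    rw [← Real.rpow_add_one hσ0.ne']; ring_nf
  set P := σ ^ (a - 1) with hP
  have hP0 : 0 < P := Real.rpow_pos_of_pos hσ0 _
  have hder : σ ^ a + 2 * τ ^ 2 * (a * P) = P * (σ - (n + 1) * τ ^ 2) := by
    rw [e1, ha]; ring
  have hneg : σ - (n + 1) * τ ^ 2 ≤ 0 := by
    have : (0 : ℝ) ≤ n * τ ^ 2 := by positivity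
    nlinarith [sq_nonneg r]
  refine ⟨?_, by positivity, ?_, ?_, ?_⟩
  · rw [e2, ha]; ring
  · rw [hder]
    exact mul_nonpos_of_nonneg_of_nonpos hP0.le hneg
  · rw [hder, abs_of_nonpos (mul_nonpos_of_nonneg_of_nonpos hP0.le hneg), e1]
    have h1 : (n + 1) * (τ * P) * τ ≤ (n + 1) * (τ * P) * σ := by gcongr
    have h2 : 0 ≤ P * σ := by positivity
    linarith
  · have hmono : σ ^ a ≤ (τ * (τ - r)) ^ a :=
      Real.rpow_le_rpow_of_nonpos (by positivity) hστ (by rw [ha]; linarith [n.cast_nonneg (α := ℝ)])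
    rw [Real.mul_rpow (by linarith) (by linarith)] at hmono
    calc τ * σ ^ a ≤ τ * (τ ^ a * (τ - r) ^ a) := by gcongr
      _ = τ ^ (-(((n : ℝ) - 1) / 2)) * (τ - r) ^ a := by
        rw [← mul_assoc, mul_comm τ, ← Real.rpow_add_one (by linarith)]
        congr 2
        rw [ha]; ring

lemma integral_rpow_neg_le {m τ : ℝ} (hm : 1 < m) (hτ : 1 ≤ τ) :
    ∫ r in (0 : ℝ)..(τ - 1), (τ - r) ^ (-m) ≤ 1 / (m - 1) := by
  rw [intervalIntegral.integral_comp_sub_left (fun r => r ^ (-m)) τ, integral_rpow]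
  · have h1 : (0 : ℝ) ≤ τ ^ (-m + 1) := Real.rpow_nonneg (by linarith) _
    have h2 : (1 : ℝ) ^ (-m + 1) = 1 := Real.one_rpow _
    have h3 : τ - (τ - 1) = 1 := by ring
    rw [h3, sub_zero, h2, show -m + 1 = -(m - 1) by ring] at *
    rw [div_neg, ← neg_div]
    gcongr
    linarith
  · right
    refine ⟨by linarith, ?_⟩
    rw [uIcc_of_le (by linarith)]
    simp only [mem_Icc, not_and, not_le]
    intro h
    linarith

lemma setIntegral_closedBall_rpow_le (hn : 1 ≤ n) {m τ : ℝ} (hm : 1 < m) (hτ : 1 ≤ τ) :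
    ∫ x in Metric.closedBall (0 : EuclideanSpace ℝ (Fin n)) (τ - 1), (τ - ‖x‖) ^ (-m)
      ≤ n * volume.real (Metric.ball (0 : EuclideanSpace ℝ (Fin n)) 1) / (m - 1)
        * τ ^ ((n : ℝ) - 1) := by
  have : Nonempty (Fin n) := ⟨⟨0, hn⟩⟩
  set f : ℝ → ℝ := (Iic (τ - 1)).indicator fun r => (τ - r) ^ (-m) with hf
  have hcont : ContinuousOn (fun r : ℝ => (τ - r) ^ (-m)) (Icc 0 (τ - 1)) := by
    refine ContinuousOn.rpow_const (by fun_prop) fun r hr => Or.inl ?_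
    have := hr.2
    linarith
  have h1 : ∫ x in Metric.closedBall (0 : EuclideanSpace ℝ (Fin n)) (τ - 1), (τ - ‖x‖) ^ (-m)
      = ∫ x : EuclideanSpace ℝ (Fin n), f ‖x‖ := by
    rw [← integral_indicator Metric.isClosed_closedBall.measurableSet]
    congr 1
    funext x
    simp [hf, indicator]
  have h2 : ∫ y in Ioi (0 : ℝ), y ^ (n - 1) • f y
      = ∫ y in (0 : ℝ)..(τ - 1), y ^ (n - 1) * (τ - y) ^ (-m) := by
    rw [intervalIntegral.integral_of_le (by linarith), ← Ioi_inter_Iic, ← setIntegral_indicator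
      measurableSet_Iic]
    refine setIntegral_congr_fun measurableSet_Ioi fun y _ => ?_
    simp [hf, indicator]
  have h3 : ∫ y in (0 : ℝ)..(τ - 1), y ^ (n - 1) * (τ - y) ^ (-m)
      ≤ ∫ y in (0 : ℝ)..(τ - 1), τ ^ (n - 1) * (τ - y) ^ (-m) := by
    refine intervalIntegral.integral_mono_on (by linarith) ?_ ?_ fun y hy => ?_
    · refine ContinuousOn.intervalIntegrable ?_
      rw [uIcc_of_le (by linarith)]
      exact (by fun_prop : ContinuousOn (fun y : ℝ => y ^ (n - 1)) _).mul hcont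
    · refine ContinuousOn.intervalIntegrable ?_
      rw [uIcc_of_le (by linarith)]
      exact continuousOn_const.mul hcont
    · have h4 : 0 ≤ (τ - y) ^ (-m) := Real.rpow_nonneg (by linarith [hy.2]) _
      have h5 := hy.1
      have h6 : y ≤ τ := by linarith [hy.2]
      gcongr
  rw [h1, integral_fun_norm_addHaar volume f, finrank_euclideanSpace_fin, h2, nsmul_eq_mul,
    smul_eq_mul]
  have h7 : τ ^ ((n : ℝ) - 1) = τ ^ (n - 1) := by
    rw [← Real.rpow_natCast, Nat.cast_sub hn, Nat.cast_one]
  rw [intervalIntegral.integral_const_mul] at h3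
  have h8 : (0 : ℝ) ≤ τ ^ (n - 1) := by positivity
  have h9 := h3.trans (mul_le_mul_of_nonneg_left (integral_rpow_neg_le hm hτ) h8)
  rw [h7]
  calc _ ≤ (n : ℝ) * (volume.real (Metric.ball (0 : EuclideanSpace ℝ (Fin n)) 1)
        * (τ ^ (n - 1) * (1 / (m - 1)))) := by gcongr
    _ = _ := by ring

lemma rpow_le_of_mem_Icc {e lo hi T τ : ℝ} (hlo : 0 < lo) (hlohi : lo ≤ hi) (hT : 0 < T)
    (h1 : lo * T ≤ τ) (h2 : τ ≤ hi * T) : τ ^ e ≤ (hi ^ e + lo ^ e) * T ^ e := by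
  have hhi : 0 < hi := hlo.trans_le hlohi
  have hT' : 0 < T ^ e := Real.rpow_pos_of_pos hT e
  have hτ : 0 < τ := (mul_pos hlo hT).trans_le h1
  rw [add_mul, ← Real.mul_rpow hhi.le hT.le, ← Real.mul_rpow hlo.le hT.le]
  rcases le_total 0 e with he | he
  · have := Real.rpow_le_rpow hτ.le h2 he
    have : 0 ≤ (lo * T) ^ e := by positivity
    linarith
  · have := Real.rpow_le_rpow_of_nonpos (mul_pos hlo hT) h1 he
    have : 0 ≤ (hi * T) ^ e := by positivity
    linarith

/-- The part of the truncated cone in the time interval `(T/2, T)`. -/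
def upperCone (n : ℕ) (R T : ℝ) : Set (ℝ × EuclideanSpace ℝ (Fin n)) :=
  truncCone n R T ∩ {z | T / 2 < z.1}

lemma measurableSet_upperCone {R T : ℝ} : MeasurableSet (upperCone n R T) :=
  measurableSet_truncCone.inter (measurableSet_lt measurable_const measurable_fst)

lemma exists_integral_waveKernel_le (hn : 1 ≤ n) {R s : ℝ} (hR : 0 < R) (hs : 1 < s)
    {Ψ : ℝ × EuclideanSpace ℝ (Fin n) → ℝ} (hΨc : Continuous Ψ)
    (hΨ0 : ∀ z, 0 ≤ z.1 → ‖z.2‖ ≤ R + z.1 → 0 ≤ Ψ z)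
    (hΨ : ∀ z, 0 ≤ z.1 → ‖z.2‖ ≤ R + z.1 → Ψ z ≤ (z.1 + (R + 1)) ^ (-(((n : ℝ) - 1) / 2))
          * (z.1 + (R + 1) - ‖z.2‖) ^ (-(((n : ℝ) + 1) / 2))) :
    ∃ C > 0, ∀ T ≥ 1, ∫ z in upperCone n R T, Ψ z ^ s ≤ C * T ^ (n - ((n : ℝ) - 1) * s / 2) := by
  set m : ℝ := ((n : ℝ) + 1) / 2 * s with hm
  have hn1 : (1 : ℝ) ≤ n := by exact_mod_cast hn
  have hm1 : 1 < m := by rw [hm]; nlinarith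
  set A : ℝ := n * volume.real (Metric.ball (0 : EuclideanSpace ℝ (Fin n)) 1) / (m - 1) with hA
  have hA0 : 0 ≤ A := div_nonneg (by positivity) (by linarith)
  set e : ℝ := ((n : ℝ) - 1) - ((n : ℝ) - 1) * s / 2 with he
  set B : ℝ := (R + 2) ^ e + (1 / 2 : ℝ) ^ e with hB
  have hB0 : 0 ≤ B := by positivity
  have hslice : ∀ T ≥ (1 : ℝ), ∀ t ∈ Ioo (T / 2) T,
      ∫ x in Metric.closedBall (0 : EuclideanSpace ℝ (Fin n)) (R + t), Ψ (t, x) ^ s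
        ≤ A * B * T ^ e := by
    intro T hT t ht
    have ht0 : 0 < t := by linarith [ht.1]
    set τ := t + (R + 1) with hτ
    have hτ1 : 1 ≤ τ := by linarith
    have hball : Metric.closedBall (0 : EuclideanSpace ℝ (Fin n)) (R + t)
        = Metric.closedBall 0 (τ - 1) := by
      congr 1; rw [hτ]; ring
    have hpt : ∀ x ∈ Metric.closedBall (0 : EuclideanSpace ℝ (Fin n)) (R + t),
        Ψ (t, x) ^ s ≤ τ ^ (-(((n : ℝ) - 1) / 2 * s)) * (τ - ‖x‖) ^ (-m) := by
      intro x hx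
      rw [mem_closedBall_zero_iff] at hx
      have hτx : 0 < τ - ‖x‖ := by linarith
      have h1 := Real.rpow_le_rpow (hΨ0 (t, x) ht0.le hx) (hΨ (t, x) ht0.le hx)
        (by linarith : (0 : ℝ) ≤ s)
      simp only at h1
      rw [Real.mul_rpow (by positivity) (Real.rpow_nonneg hτx.le _), ← Real.rpow_mul (by positivity),
        ← Real.rpow_mul hτx.le] at h1
      refine h1.trans_eq ?_
      rw [hm]
      congr 2 <;> ring
    have hcont : ContinuousOn (fun x : EuclideanSpace ℝ (Fin n) => (τ - ‖x‖) ^ (-m))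
        (Metric.closedBall 0 (R + t)) := by
      refine ContinuousOn.rpow_const (by fun_prop) fun x hx => Or.inl ?_
      rw [mem_closedBall_zero_iff] at hx
      linarith
    calc _ ≤ ∫ x in Metric.closedBall (0 : EuclideanSpace ℝ (Fin n)) (R + t),
          τ ^ (-(((n : ℝ) - 1) / 2 * s)) * (τ - ‖x‖) ^ (-m) := by
          refine setIntegral_mono_on ?_ ?_ Metric.isClosed_closedBall.measurableSet hpt
          · refine ContinuousOn.integrableOn_compact (isCompact_closedBall _ _) ?_
            exact (((hΨc.comp (by fun_prop : Continuous fun x => (t, x)))).rpow_const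
              fun _ => Or.inr (by linarith)).continuousOn
          · exact ContinuousOn.integrableOn_compact (isCompact_closedBall _ _)
              (continuousOn_const.mul hcont)
      _ ≤ τ ^ (-(((n : ℝ) - 1) / 2 * s)) * (A * τ ^ ((n : ℝ) - 1)) := by
          rw [integral_const_mul, hball]
          have h0 : 0 ≤ τ ^ (-(((n : ℝ) - 1) / 2 * s)) := by positivity
          exact mul_le_mul_of_nonneg_left (setIntegral_closedBall_rpow_le hn hm1 hτ1) h0
      _ = A * τ ^ e := by
          rw [mul_left_comm, ← Real.rpow_add (by positivity)]
          congr 2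
          rw [he]; ring
      _ ≤ A * (B * T ^ e) := by
          refine mul_le_mul_of_nonneg_left ?_ hA0
          refine rpow_le_of_mem_Icc (by norm_num) (by linarith) (by linarith) ?_ ?_
          · linarith [ht.1]
          · have := ht.2
            nlinarith
      _ = _ := by ring
  refine ⟨A * B + 1, by positivity, fun T hT => ?_⟩
  have hT0 : 0 < T := by linarith
  have hset : ∀ t ∈ Ioo (T / 2) T, ∀ x : EuclideanSpace ℝ (Fin n),
      (t, x) ∈ upperCone n R T ↔ x ∈ Metric.closedBall 0 (R + t) := by
    intro t ht x
    rw [mem_closedBall_zero_iff]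
    have : 0 < t := by linarith [ht.1]
    exact ⟨fun h => h.1.2.2, fun h => ⟨⟨this, ht.2, h⟩, ht.1⟩⟩
  have hint : IntegrableOn (fun z => Ψ z ^ s) (upperCone n R T) :=
    (integrableOn_truncCone (hΨc.rpow_const fun _ => Or.inr (by linarith))).mono_set
      inter_subset_left
  have hslices : ∫ z in upperCone n R T, Ψ z ^ s = ∫ t in Ioo (T / 2) T,
      ∫ x in Metric.closedBall (0 : EuclideanSpace ℝ (Fin n)) (R + t), Ψ (t, x) ^ s := by
    rw [← integral_indicator measurableSet_upperCone, Measure.volume_eq_prod, integral_prod]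
    · rw [← integral_indicator measurableSet_Ioo]
      congr 1
      funext t
      by_cases ht : t ∈ Ioo (T / 2) T
      · rw [indicator_of_mem ht, ← integral_indicator Metric.isClosed_closedBall.measurableSet]
        congr 1
        funext x
        by_cases hx : x ∈ Metric.closedBall 0 (R + t)
        · rw [indicator_of_mem hx, indicator_of_mem ((hset t ht x).2 hx)]
        · rw [indicator_of_notMem hx, indicator_of_notMem fun h => hx ((hset t ht x).1 h)]
      · rw [indicator_of_notMem ht]
        refine integral_eq_zero_of_ae (Filter.Eventually.of_forall fun x => ?_)
        exact indicator_of_notMem (fun h => ht ⟨h.2, h.1.2.1⟩) _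
    · rw [← Measure.volume_eq_prod]
      exact hint.integrable_indicator measurableSet_upperCone
  have hbound : ‖∫ t in Ioo (T / 2) T, ∫ x in Metric.closedBall (0 : EuclideanSpace ℝ (Fin n))
      (R + t), Ψ (t, x) ^ s‖ ≤ A * B * T ^ e * volume.real (Ioo (T / 2) T) := by
    refine norm_setIntegral_le_of_norm_le_const (by simp) fun t ht => ?_
    rw [Real.norm_of_nonneg]
    · exact hslice T hT t ht
    · refine setIntegral_nonneg Metric.isClosed_closedBall.measurableSet fun x hx => ?_
      rw [mem_closedBall_zero_iff] at hx
      exact Real.rpow_nonneg (hΨ0 (t, x) (by simp only; linarith [ht.1]) hx) _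
  rw [hslices]
  refine (le_abs_self _).trans (hbound.trans ?_)
  rw [Real.volume_real_Ioo_of_le (by linarith)]
  have hTe : 0 ≤ T ^ e := by positivity
  calc A * B * T ^ e * (T - T / 2) ≤ (A * B + 1) * T ^ e * T := by
        refine mul_le_mul ?_ (by linarith) (by linarith) (by positivity)
        exact mul_le_mul_of_nonneg_right (by linarith) hTe
    _ = (A * B + 1) * T ^ (n - ((n : ℝ) - 1) * s / 2) := by
        rw [mul_assoc, ← Real.rpow_add_one hT0.ne']
        congr 2
        rw [he]; ring

end KernelEstimates

section Holder

variable {n : ℕ} {R T : ℝ}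

lemma setIntegral_truncCone_mul_le {r r' M : ℝ} (hr : r.HolderConjugate r') (hM : 0 ≤ M)
    {S : Set (ℝ × EuclideanSpace ℝ (Fin n))} (hS : MeasurableSet S) (hSK : S ⊆ truncCone n R T)
    {W G Ψ θ : ℝ × EuclideanSpace ℝ (Fin n) → ℝ} (hW : Continuous W) (hG : Continuous G)
    (hΨ : Continuous Ψ) (hθ : Continuous θ) (hθ0 : ∀ z, 0 ≤ θ z) (hΨ0 : ∀ z ∈ S, 0 ≤ Ψ z)
    (hGS : ∀ z ∈ S, |G z| ≤ M * (θ z ^ (1 / r) * Ψ z))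
    (hG0 : ∀ z ∈ truncCone n R T, z ∉ S → G z = 0) :
    ∫ z in truncCone n R T, W z * G z
      ≤ M * ((∫ z in truncCone n R T, |W z| ^ r * θ z) ^ (1 / r)
        * (∫ z in S, Ψ z ^ r') ^ (1 / r')) := by
  have hr0 := hr.pos
  have hr'0 := hr.symm.pos
  set f : ℝ × EuclideanSpace ℝ (Fin n) → ℝ := fun z => |W z| * θ z ^ (1 / r) with hf
  have hfc : Continuous f :=
    hW.abs.mul (hθ.rpow_const fun _ => Or.inr (one_div_nonneg.2 hr0.le))
  have hf0 (z) : 0 ≤ f z := mul_nonneg (abs_nonneg _) (Real.rpow_nonneg (hθ0 z) _)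
  have hint {h : ℝ × EuclideanSpace ℝ (Fin n) → ℝ} (hc : Continuous h) : IntegrableOn h S :=
    (integrableOn_truncCone hc).mono_set hSK
  have hmem {h : ℝ × EuclideanSpace ℝ (Fin n) → ℝ} (hc : Continuous h) {s : ℝ} (hs : 0 < s) :
      MemLp h (ENNReal.ofReal s) (volume.restrict S) := by
    refine (integrable_norm_rpow_iff hc.aestronglyMeasurable
      (by simpa using hs) ENNReal.ofReal_ne_top).1 ?_
    rw [ENNReal.toReal_ofReal hs.le]
    exact hint (hc.norm.rpow_const fun _ => Or.inr hs.le)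
  have hfr (z) : f z ^ r = |W z| ^ r * θ z := by
    rw [hf]
    simp only
    rw [Real.mul_rpow (abs_nonneg _) (Real.rpow_nonneg (hθ0 z) _), ← Real.rpow_mul (hθ0 z),
      one_div_mul_cancel hr0.ne', Real.rpow_one]
  have hWr : Continuous fun z => |W z| ^ r * θ z :=
    (hW.abs.rpow_const fun _ => Or.inr hr0.le).mul hθ
  have hWr0 (z) : 0 ≤ |W z| ^ r * θ z := mul_nonneg (Real.rpow_nonneg (abs_nonneg _) _) (hθ0 z)
  calc ∫ z in truncCone n R T, W z * G z = ∫ z in S, W z * G z :=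
        (setIntegral_eq_of_subset_of_forall_sdiff_eq_zero measurableSet_truncCone hSK
          fun z hz => by rw [hG0 z hz.1 hz.2, mul_zero])
    _ ≤ ∫ z in S, M * (f z * Ψ z) := by
        refine setIntegral_mono_on (hint (hW.mul hG)) (hint (continuous_const.mul (hfc.mul hΨ)))
          hS fun z hz => ?_
        calc W z * G z ≤ |W z| * |G z| := by rw [← abs_mul]; exact le_abs_self _
          _ ≤ |W z| * (M * (θ z ^ (1 / r) * Ψ z)) :=
            mul_le_mul_of_nonneg_left (hGS z hz) (abs_nonneg _)
          _ = M * (f z * Ψ z) := by simp only [hf]; ring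
    _ = M * ∫ z in S, f z * Ψ z := integral_const_mul _ _
    _ ≤ M * ((∫ z in S, f z ^ r) ^ (1 / r) * (∫ z in S, Ψ z ^ r') ^ (1 / r')) := by
        refine mul_le_mul_of_nonneg_left ?_ hM
        exact integral_mul_le_Lp_mul_Lq_of_nonneg hr (ae_of_all _ hf0)
          (ae_restrict_of_forall_mem hS hΨ0) (hmem hfc hr0) (hmem hΨ hr'0)
    _ ≤ _ := by
        simp_rw [hfr]
        have hΨr : 0 ≤ ∫ z in S, Ψ z ^ r' :=
          setIntegral_nonneg hS fun z hz => Real.rpow_nonneg (hΨ0 z hz) _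
        have hWS : 0 ≤ ∫ z in S, |W z| ^ r * θ z := setIntegral_nonneg hS fun z _ => hWr0 z
        exact mul_le_mul_of_nonneg_left (mul_le_mul_of_nonneg_right (Real.rpow_le_rpow hWS
          (setIntegral_mono_set (integrableOn_truncCone hWr) (ae_of_all _ hWr0) hSK.eventuallyLE)
          (one_div_nonneg.2 hr0.le)) (Real.rpow_nonneg hΨr _)) hM

lemma exists_volume_truncCone_le (n : ℕ) {R : ℝ} (hR : 0 < R) :
    ∃ D > 0, ∀ T ≥ 1, volume.real (truncCone n R T) ≤ D * T ^ ((n : ℝ) + 1) := by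
  refine ⟨(R + 1) ^ n * volume.real (Metric.ball (0 : EuclideanSpace ℝ (Fin n)) 1), ?_,
    fun T hT => ?_⟩
  · have : 0 < volume.real (Metric.ball (0 : EuclideanSpace ℝ (Fin n)) 1) :=
      ENNReal.toReal_pos (Metric.measure_ball_pos _ _ one_pos).ne' measure_ball_lt_top.ne
    positivity
  have hT0 : 0 < T := one_pos.trans_le hT
  calc volume.real (truncCone n R T)
      ≤ volume.real (Icc 0 T ×ˢ Metric.closedBall (0 : EuclideanSpace ℝ (Fin n)) (R + T)) :=
        measureReal_mono truncCone_subset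
          (isCompact_Icc.prod (isCompact_closedBall _ _)).measure_lt_top.ne
    _ = T * ((R + T) ^ n * volume.real (Metric.ball (0 : EuclideanSpace ℝ (Fin n)) 1)) := by
        rw [Measure.volume_eq_prod, measureReal_prod_prod,
          Measure.addHaar_real_closedBall _ _ (by positivity)]
        simp [hT0.le]
    _ ≤ T * (((R + 1) * T) ^ n * volume.real (Metric.ball (0 : EuclideanSpace ℝ (Fin n)) 1)) := by
        gcongr
        nlinarith
    _ = _ := by
        rw [Real.rpow_add hT0, Real.rpow_natCast, Real.rpow_one, mul_pow]
        ring

end Holder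

section TestFunction

variable {n : ℕ} {R T a C : ℝ} {η : ℝ → ℝ}

lemma integral_dAlembert_mul_timeRescale (hT : 0 < T) (ha : 0 < a) (hη : IsTimeCutoff a C η)
    {W Ψ : ℝ × EuclideanSpace ℝ (Fin n) → ℝ} (hW : ContDiff ℝ 2 W) (hΨ : ContDiff ℝ 2 Ψ)
    (h0 : ∀ z ∈ coneExterior n R T, W z = 0) (hΨK : ∀ z ∈ truncCone n R T, dAlembert Ψ z = 0) :
    (∫ z in truncCone n R T, dAlembert W z * (Ψ z * η (z.1 / T)))
      + ∫ x, (dirDeriv W (1, 0) (0, x) * Ψ (0, x) - W (0, x) * dirDeriv Ψ (1, 0) (0, x))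
      = ∫ z in truncCone n R T, W z * (2 * dirDeriv Ψ (1, 0) z * (deriv η (z.1 / T) / T)
        + Ψ z * (deriv (deriv η) (z.1 / T) / T ^ 2)) := by
  have hΦ : ContDiff ℝ 2 fun z : ℝ × EuclideanSpace ℝ (Fin n) => Ψ z * η (z.1 / T) :=
    hΨ.mul (hη.contDiff.comp (contDiff_fst.div_const T))
  have h := integral_dAlembert_mul hT hW hΦ h0
    (fun x => by simp [div_self hT.ne', hη.eq_zero 1 le_rfl])
    (fun x => by
      rw [dirDeriv_mul_timeRescale hη.contDiff hΨ]
      simp [div_self hT.ne', hη.eq_zero 1 le_rfl, hη.deriv_one ha])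
  simp only [dirDeriv_mul_timeRescale hη.contDiff hΨ, zero_div, hη.eq_one 0 (by norm_num),
    hη.deriv_eq_zero 0 (by norm_num), mul_one, mul_zero, add_zero] at h
  rw [h]
  refine setIntegral_congr_fun measurableSet_truncCone fun z hz => ?_
  simp only [dAlembert_mul_timeRescale hη.contDiff hΨ, hΨK z hz, zero_mul, zero_add]

lemma dirDeriv_const {F : Type*} [NormedAddCommGroup F] [NormedSpace ℝ F] (c : ℝ) (d : F) :
    dirDeriv (fun _ : F => c) d = fun _ => 0 := by
  funext z
  simp [dirDeriv]

lemma dAlembert_const (c : ℝ) :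
    dAlembert (fun _ : ℝ × EuclideanSpace ℝ (Fin n) => c) = fun _ => 0 := by
  funext z
  simp [dAlembert, dirDeriv_const]

/-- Integration against the spatially constant cutoff `η (t / T)`. -/
lemma integral_dAlembert_mul_cutoff (hT : 0 < T) (ha : 0 < a) (hη : IsTimeCutoff a C η)
    {W : ℝ × EuclideanSpace ℝ (Fin n) → ℝ} (hW : ContDiff ℝ 2 W)
    (h0 : ∀ z ∈ coneExterior n R T, W z = 0) :
    (∫ z in truncCone n R T, dAlembert W z * η (z.1 / T)) + ∫ x, dirDeriv W (1, 0) (0, x)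
      = ∫ z in truncCone n R T, W z * (deriv (deriv η) (z.1 / T) / T ^ 2) := by
  simpa [dirDeriv_const] using integral_dAlembert_mul_timeRescale hT ha hη hW
    (contDiff_const (c := (1 : ℝ))) h0 (fun z _ => by rw [dAlembert_const])

/-- Integration of the damped wave operator against the cutoff `η (t / T)`. -/
lemma integral_damped_mul_cutoff (hT : 0 < T) (ha : 0 < a) (hη : IsTimeCutoff a C η)
    {W : ℝ × EuclideanSpace ℝ (Fin n) → ℝ} (hW : ContDiff ℝ 2 W)
    (h0 : ∀ z ∈ coneExterior n R T, W z = 0) :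
    (∫ z in truncCone n R T, (dAlembert W z + dirDeriv W (1, 0) z) * η (z.1 / T))
      + ((∫ x, dirDeriv W (1, 0) (0, x)) + ∫ x, W (0, x))
      = ∫ z in truncCone n R T,
          W z * (deriv (deriv η) (z.1 / T) / T ^ 2 - deriv η (z.1 / T) / T) := by
  have hΘ : ContDiff ℝ 1 fun z : ℝ × EuclideanSpace ℝ (Fin n) => η (z.1 / T) :=
    (hη.contDiff.of_le one_le_two).comp (contDiff_fst.div_const T)
  have hs : Continuous fun z : ℝ × EuclideanSpace ℝ (Fin n) => z.1 / T :=
    continuous_fst.div_const T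
  have hW1 : Continuous (dirDeriv W (1, 0)) := (hW.dirDeriv (m := 1)
    (by norm_num [one_add_one_eq_two]) (1, 0)).continuous
  have h1 := integral_dAlembert_mul_cutoff hT ha hη hW h0
  have h2 := integral_dirDeriv_time_mul hT (hW.of_le one_le_two) hΘ h0
    (fun x => by simp [div_self hT.ne', hη.eq_zero 1 le_rfl])
  rw [dirDeriv_timeRescale (hη.contDiff.differentiable two_ne_zero)] at h2
  simp only [zero_div, hη.eq_one 0 (by norm_num), mul_one] at h2
  simp_rw [add_mul, mul_sub]
  rw [integral_add, integral_sub]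
  · linarith
  · exact integrableOn_truncCone
      (hW.continuous.mul ((hη.continuous_deriv_deriv.comp hs).div_const _))
  · exact integrableOn_truncCone (hW.continuous.mul ((hη.continuous_deriv.comp hs).div_const _))
  · exact integrableOn_truncCone ((continuous_dAlembert hW).mul hΘ.continuous)
  · exact integrableOn_truncCone (hW1.mul hΘ.continuous)

end TestFunction

section Estimates

variable {n : ℕ} {R C : ℝ} {η : ℝ → ℝ}

/-- Hölder's inequality on the truncated cone for weights controlled by a power of the cutoff. -/
lemma exists_cutoff_integral_le {r : ℝ} (hR : 0 < R) (hr : 1 < r)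
    (hη : IsTimeCutoff (1 / r) C η) :
    ∃ k > 0, ∀ T ≥ 1, ∀ M ≥ 0, ∀ W G : ℝ × EuclideanSpace ℝ (Fin n) → ℝ, Continuous W →
      Continuous G → (∀ z, |G z| ≤ M * η (z.1 / T) ^ (1 / r)) →
      ∫ z in truncCone n R T, W z * G z ≤ k * M * T ^ (((n : ℝ) + 1) * (1 - 1 / r))
        * (∫ z in truncCone n R T, |W z| ^ r * η (z.1 / T)) ^ (1 / r) := by
  obtain ⟨D, hD, hvol⟩ := exists_volume_truncCone_le n hR
  have hrr := Real.HolderConjugate.conjExponent hr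
  have hr' : 1 / r.conjExponent = 1 - 1 / r := by
    rw [one_div, one_div]; linarith [hrr.inv_add_inv_eq_one]
  have hr1 : 0 ≤ 1 - 1 / r := by rw [← hr']; exact one_div_nonneg.2 hrr.symm.pos.le
  refine ⟨D ^ (1 - 1 / r), by positivity, fun T hT M hM W G hW hG hGM => ?_⟩
  have hT0 : 0 < T := one_pos.trans_le hT
  have hθ : Continuous fun z : ℝ × EuclideanSpace ℝ (Fin n) => η (z.1 / T) :=
    hη.contDiff.continuous.comp (continuous_fst.div_const T)
  have h := setIntegral_truncCone_mul_le (R := R) (T := T) (Ψ := fun _ => 1) hrr hM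
    measurableSet_truncCone subset_rfl hW hG continuous_const hθ (fun z => hη.nonneg _)
    (fun _ _ => zero_le_one) (fun z _ => by simpa using hGM z) (fun z hz hz' => absurd hz hz')
  simp only [Real.one_rpow, integral_const, smul_eq_mul, mul_one, hr',
    measureReal_restrict_apply_univ] at h
  have hA : 0 ≤ ∫ z in truncCone n R T, |W z| ^ r * η (z.1 / T) :=
    setIntegral_nonneg measurableSet_truncCone fun z _ =>
      mul_nonneg (Real.rpow_nonneg (abs_nonneg _) _) (hη.nonneg _)
  have hv : volume.real (truncCone n R T) ^ (1 - 1 / r)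
      ≤ D ^ (1 - 1 / r) * T ^ (((n : ℝ) + 1) * (1 - 1 / r)) := by
    rw [Real.rpow_mul hT0.le, ← Real.mul_rpow hD.le (by positivity)]
    exact Real.rpow_le_rpow measureReal_nonneg (hvol T hT) hr1
  calc _ ≤ _ := h
    _ ≤ M * ((∫ z in truncCone n R T, |W z| ^ r * η (z.1 / T)) ^ (1 / r)
        * (D ^ (1 - 1 / r) * T ^ (((n : ℝ) + 1) * (1 - 1 / r)))) := by gcongr
    _ = _ := by ring

lemma exists_damped_estimate {q : ℝ} (hR : 0 < R) (hq : 1 < q)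
    (hη : IsTimeCutoff (1 / q) C η) :
    ∃ k > 0, ∀ T ≥ 1, ∀ W F : ℝ × EuclideanSpace ℝ (Fin n) → ℝ, ContDiff ℝ 2 W →
      (∀ z ∈ coneExterior n R T, W z = 0) →
      (∀ z ∈ truncCone n R T, dAlembert W z + dirDeriv W (1, 0) z = F z) →
      (∫ z in truncCone n R T, F z * η (z.1 / T))
          + ((∫ x, dirDeriv W (1, 0) (0, x)) + ∫ x, W (0, x))
        ≤ k * T ^ (((n : ℝ) + 1) * (1 - 1 / q) - 1)
          * (∫ z in truncCone n R T, |W z| ^ q * η (z.1 / T)) ^ (1 / q) := by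
  obtain ⟨k, hk, hkT⟩ := exists_cutoff_integral_le (n := n) hR hq hη
  refine ⟨k * (2 * C), by have := hη.const_pos; positivity, fun T hT W F hW h0 hF => ?_⟩
  have hT0 : 0 < T := one_pos.trans_le hT
  have hs : Continuous fun z : ℝ × EuclideanSpace ℝ (Fin n) => z.1 / T :=
    continuous_fst.div_const T
  have hid := integral_damped_mul_cutoff hT0 (by positivity) hη hW h0
  rw [setIntegral_congr_fun measurableSet_truncCone
    (g := fun z => F z * η (z.1 / T)) fun z hz => by simp only [hF z hz]] at hid
  rw [hid]
  refine (hkT T hT (2 * C / T) (by have := hη.const_pos; positivity) W _ hW.continuous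
    (((hη.continuous_deriv_deriv.comp hs).div_const _).sub
      ((hη.continuous_deriv.comp hs).div_const _)) fun z => ?_).trans_eq ?_
  · have h1 := hη.abs_deriv_le (z.1 / T)
    have h2 := hη.abs_deriv_deriv_le (z.1 / T)
    calc |deriv (deriv η) (z.1 / T) / T ^ 2 - deriv η (z.1 / T) / T|
        ≤ |deriv (deriv η) (z.1 / T) / T ^ 2| + |deriv η (z.1 / T) / T| := abs_sub _ _
      _ = |deriv (deriv η) (z.1 / T)| / T ^ 2 + |deriv η (z.1 / T)| / T := by
        rw [abs_div, abs_div, abs_of_pos hT0, abs_of_pos (pow_pos hT0 2)]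
      _ ≤ |deriv (deriv η) (z.1 / T)| / T + |deriv η (z.1 / T)| / T := by
        gcongr
        exact le_self_pow₀ hT two_ne_zero
      _ ≤ C * η (z.1 / T) ^ (1 / q) / T + C * η (z.1 / T) ^ (1 / q) / T := by gcongr
      _ = _ := by ring
  · rw [Real.rpow_sub hT0, Real.rpow_one]
    ring

lemma exists_wave_estimate {p : ℝ} (hR : 0 < R) (hp : 1 < p)
    (hη : IsTimeCutoff (1 / p) C η) :
    ∃ k > 0, ∀ T ≥ 1, ∀ W F : ℝ × EuclideanSpace ℝ (Fin n) → ℝ, ContDiff ℝ 2 W →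
      (∀ z ∈ coneExterior n R T, W z = 0) →
      (∀ z ∈ truncCone n R T, dAlembert W z = F z) →
      (∫ z in truncCone n R T, F z * η (z.1 / T)) + ∫ x, dirDeriv W (1, 0) (0, x)
        ≤ k * T ^ (((n : ℝ) + 1) * (1 - 1 / p) - 2)
          * (∫ z in truncCone n R T, |W z| ^ p * η (z.1 / T)) ^ (1 / p) := by
  obtain ⟨k, hk, hkT⟩ := exists_cutoff_integral_le (n := n) hR hp hη
  refine ⟨k * C, by have := hη.const_pos; positivity, fun T hT W F hW h0 hF => ?_⟩
  have hT0 : 0 < T := one_pos.trans_le hT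
  have hs : Continuous fun z : ℝ × EuclideanSpace ℝ (Fin n) => z.1 / T :=
    continuous_fst.div_const T
  have hid := integral_dAlembert_mul_cutoff hT0 (by positivity) hη hW h0
  rw [setIntegral_congr_fun measurableSet_truncCone
    (g := fun z => F z * η (z.1 / T)) fun z hz => by simp only [hF z hz]] at hid
  rw [hid]
  refine (hkT T hT (C / T ^ 2) (by have := hη.const_pos; positivity) W _ hW.continuous
    ((hη.continuous_deriv_deriv.comp hs).div_const _) fun z => ?_).trans_eq ?_
  · rw [abs_div, abs_of_pos (pow_pos hT0 2), div_mul_eq_mul_div]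
    exact div_le_div_of_nonneg_right (hη.abs_deriv_deriv_le _) (by positivity)
  · rw [Real.rpow_sub hT0, Real.rpow_two]
    ring

lemma exists_waveKernel_estimate (hn : 1 ≤ n) {p : ℝ} (hR : 0 < R) (hp : 1 < p)
    (hη : IsTimeCutoff (1 / p) C η) :
    ∃ Ψ₀ : EuclideanSpace ℝ (Fin n) → ℝ, Continuous Ψ₀ ∧ (∀ x, ‖x‖ ≤ R → 0 < Ψ₀ x) ∧
    ∃ k > 0, ∀ T ≥ 1, ∀ W : ℝ × EuclideanSpace ℝ (Fin n) → ℝ, ContDiff ℝ 2 W →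
      (∀ z ∈ coneExterior n R T, W z = 0) →
      (∀ z ∈ truncCone n R T, 0 ≤ dAlembert W z) →
      (∀ x, 0 ≤ W (0, x)) → (∀ x, R < ‖x‖ → W (0, x) = 0) →
      (∀ x, R < ‖x‖ → dirDeriv W (1, 0) (0, x) = 0) →
      ∫ x, dirDeriv W (1, 0) (0, x) * Ψ₀ x
        ≤ k * T ^ ((n : ℝ) - n / p - 1 - ((n : ℝ) - 1) / 2)
          * (∫ z in truncCone n R T, |W z| ^ p * η (z.1 / T)) ^ (1 / p) := by
  obtain ⟨Ψ, hΨ, hK⟩ := exists_waveKernel n hR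
  have hΨc := hΨ.continuous
  have hΨdc : Continuous (dirDeriv Ψ (1, 0)) := (hΨ.dirDeriv (m := 1)
    (by norm_num [one_add_one_eq_two]) (1, 0)).continuous
  have hpp := Real.HolderConjugate.conjExponent hp
  set s := p.conjExponent with hs
  have hs' : 1 / s = 1 - 1 / p := by
    rw [one_div, one_div]; linarith [hpp.inv_add_inv_eq_one]
  have hs0 : 0 < s := hpp.symm.pos
  have hs1 : 0 ≤ 1 / s := one_div_nonneg.2 hs0.le
  obtain ⟨D, hD, hDT⟩ := exists_integral_waveKernel_le hn hR hpp.symm.lt hΨc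
    (fun z h1 h2 => (hK z h1 h2).2.1.le) fun z h1 h2 => (hK z h1 h2).2.2.2.2
  have hC := hη.const_pos
  refine ⟨fun x => Ψ (0, x), hΨc.comp (by fun_prop), fun x hx =>
    (hK (0, x) le_rfl (by simpa using hx)).2.1,
    (2 * n + 3) * C * D ^ (1 / s), by positivity, fun T hT W hW h0 hF hW0 hW0R hW1R => ?_⟩
  have hT0 : 0 < T := one_pos.trans_le hT
  have hc : Continuous fun z : ℝ × EuclideanSpace ℝ (Fin n) => z.1 / T :=
    continuous_fst.div_const T
  have hWd : Continuous (dirDeriv W (1, 0)) := (hW.dirDeriv (m := 1)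
    (by norm_num [one_add_one_eq_two]) (1, 0)).continuous
  have hid := integral_dAlembert_mul_timeRescale hT0 (by positivity) hη hW hΨ h0
    fun z hz => (hK z hz.1.le hz.2.2).1
  have hF0 : 0 ≤ ∫ z in truncCone n R T, dAlembert W z * (Ψ z * η (z.1 / T)) :=
    setIntegral_nonneg measurableSet_truncCone fun z hz =>
      mul_nonneg (hF z hz) (mul_nonneg (hK z hz.1.le hz.2.2).2.1.le (hη.nonneg _))
  have hint {f : EuclideanSpace ℝ (Fin n) → ℝ} (hf : Continuous f)
      (hfR : ∀ x, R < ‖x‖ → f x = 0) : Integrable f :=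
    hf.integrable_of_hasCompactSupport <| HasCompactSupport.intro (isCompact_closedBall 0 R)
      fun x hx => hfR x (by simpa using hx)
  have hdata : ∫ x, dirDeriv W (1, 0) (0, x) * Ψ (0, x)
      ≤ ∫ x, (dirDeriv W (1, 0) (0, x) * Ψ (0, x) - W (0, x) * dirDeriv Ψ (1, 0) (0, x)) := by
    have hc0 : Continuous fun x : EuclideanSpace ℝ (Fin n) => ((0 : ℝ), x) := by fun_prop
    have hi1 := (hWd.comp hc0).mul (hΨc.comp hc0)
    have hi2 := (hW.continuous.comp hc0).mul (hΨdc.comp hc0)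
    refine integral_mono (hint hi1 fun x hx => ?_) (hint (hi1.sub hi2) fun x hx => ?_) fun x => ?_
    · simp [hW1R x hx]
    · simp [hW1R x hx, hW0R x hx]
    · rcases le_or_gt ‖x‖ R with hx | hx
      · have := mul_nonpos_of_nonneg_of_nonpos (hW0 x)
          (hK (0, x) le_rfl (by simpa using hx)).2.2.1
        simp only
        linarith
      · simp [hW0R x hx]
  have hSK : upperCone n R T ⊆ truncCone n R T := inter_subset_left
  have hhold := setIntegral_truncCone_mul_le (M := (2 * n + 3) * C / T) hpp (by positivity)
    measurableSet_upperCone hSK hW.continuous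
    (G := fun z => 2 * dirDeriv Ψ (1, 0) z * (deriv η (z.1 / T) / T)
        + Ψ z * (deriv (deriv η) (z.1 / T) / T ^ 2))
    (((continuous_const.mul hΨdc).mul ((hη.continuous_deriv.comp hc).div_const _)).add
      (hΨc.mul ((hη.continuous_deriv_deriv.comp hc).div_const _))) hΨc
    (hη.contDiff.continuous.comp hc) (fun z => hη.nonneg _)
    (fun z hz => (hK z (hSK hz).1.le (hSK hz).2.2).2.1.le) (fun z hz => ?_) (fun z hz hzS => ?_)
  rotate_left
  · obtain ⟨-, hΨ0, -, hΨd, -⟩ := hK z (hSK hz).1.le (hSK hz).2.2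
    have h1 := hη.abs_deriv_le (z.1 / T)
    have h2 := hη.abs_deriv_deriv_le (z.1 / T)
    have hη0 := Real.rpow_nonneg (hη.nonneg (z.1 / T)) (1 / p)
    calc _ ≤ |2 * dirDeriv Ψ (1, 0) z * (deriv η (z.1 / T) / T)|
          + |Ψ z * (deriv (deriv η) (z.1 / T) / T ^ 2)| := abs_add_le _ _
      _ = 2 * |dirDeriv Ψ (1, 0) z| * (|deriv η (z.1 / T)| / T)
          + Ψ z * (|deriv (deriv η) (z.1 / T)| / T ^ 2) := by
        simp only [abs_mul, abs_div, abs_of_pos hT0, abs_of_pos (pow_pos hT0 2), abs_of_pos hΨ0,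
          abs_two]
      _ ≤ 2 * ((n + 1) * Ψ z) * (C * η (z.1 / T) ^ (1 / p) / T)
          + Ψ z * (C * η (z.1 / T) ^ (1 / p) / T) := by
        gcongr
        exact le_self_pow₀ hT two_ne_zero
      _ = _ := by simp only [Function.comp_apply]; ring
  · have hz2 : z.1 / T ≤ 1 / 2 := by
      rw [div_le_iff₀ hT0]
      have : ¬ T / 2 < z.1 := fun h => hzS ⟨hz, h⟩
      linarith
    simp [hη.deriv_eq_zero _ hz2, hη.deriv_deriv_eq_zero _ hz2]
  have hA : 0 ≤ ∫ z in truncCone n R T, |W z| ^ p * η (z.1 / T) :=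
    setIntegral_nonneg measurableSet_truncCone fun z _ =>
      mul_nonneg (Real.rpow_nonneg (abs_nonneg _) _) (hη.nonneg _)
  have hkern : (∫ z in upperCone n R T, Ψ z ^ s) ^ (1 / s)
      ≤ D ^ (1 / s) * T ^ ((n : ℝ) - n / p - ((n : ℝ) - 1) / 2) := by
    have he : (n : ℝ) - n / p - ((n : ℝ) - 1) / 2 = (n - ((n : ℝ) - 1) * s / 2) * (1 / s) := by
      have : (n - ((n : ℝ) - 1) * s / 2) * (1 / s) = n * (1 / s) - ((n : ℝ) - 1) / 2 := by
        field_simp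
      rw [this, hs']
      ring
    rw [he, Real.rpow_mul hT0.le, ← Real.mul_rpow hD.le (by positivity)]
    exact Real.rpow_le_rpow (setIntegral_nonneg measurableSet_upperCone fun z hz =>
      Real.rpow_nonneg (hK z (hSK hz).1.le (hSK hz).2.2).2.1.le _) (hDT T hT) hs1
  calc ∫ x, dirDeriv W (1, 0) (0, x) * Ψ (0, x)
      ≤ (2 * n + 3) * C / T * ((∫ z in truncCone n R T, |W z| ^ p * η (z.1 / T)) ^ (1 / p)
        * (∫ z in upperCone n R T, Ψ z ^ s) ^ (1 / s)) :=
        hdata.trans ((le_add_of_nonneg_left hF0).trans (hid.le.trans hhold))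
    _ ≤ (2 * n + 3) * C / T * ((∫ z in truncCone n R T, |W z| ^ p * η (z.1 / T)) ^ (1 / p)
        * (D ^ (1 / s) * T ^ ((n : ℝ) - n / p - ((n : ℝ) - 1) / 2))) := by gcongr
    _ = _ := by
        rw [show (n : ℝ) - n / p - 1 - ((n : ℝ) - 1) / 2
          = (n : ℝ) - n / p - ((n : ℝ) - 1) / 2 - 1 by ring, Real.rpow_sub_one hT0.ne']
        ring

end Estimates

section Lifespan

/-- The exponents `F₁, F₃, F₄` produced by iterating the three logarithmic estimates. -/
lemma log_estimates {n p q k a b x L : ℝ} (hp : 1 < p) (hq : 1 < q) (hk : 0 ≤ k)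
    (ha : a ≤ k + b / p + ((n + 1) * (1 - 1 / p) - 2) * L)
    (hb : b ≤ k + a / q + ((n + 1) * (1 - 1 / q) - 1) * L)
    (hxa : x ≤ k + a / q + ((n + 1) * (1 - 1 / q) - 1) * L)
    (hxb : x ≤ k + b / p + ((n + 1) * (1 - 1 / p) - 2) * L)
    (hxc : x ≤ k + b / p + (n - n / p - 1 - (n - 1) / 2) * L) :
    x ≤ k * (1 + (p + q + 1) / (p * q - 1)) - ((2 + 1 / p) / (p * q - 1) - (n - 1) / 2) * L ∧
    x ≤ k * (1 + (p + q + 1) / (p * q - 1)) - ((2 + q) / (p * q - 1) - n + 1) * L ∧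
    x ≤ k * (1 + (p + q + 1) / (p * q - 1)) - ((1 + 2 * p) / (p * q - 1) - n) * L := by
  have hD : 0 < p * q - 1 := by nlinarith
  have hp0 : 0 < p := by linarith
  have hq0 : 0 < q := by linarith
  set α := (n + 1) * (1 - 1 / p) - 2 with hα
  set β := (n + 1) * (1 - 1 / q) - 1 with hβ
  have hb' : b / p ≤ k * (q + 1) / (p * q - 1) + (α + q * β) / (p * q - 1) * L := by
    rw [← mul_div_right_comm, ← add_div, div_le_div_iff₀ hp0 hD]
    have h1 : q * b ≤ q * k + (k + b / p + α * L) + q * β * L := by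
      have := mul_le_mul_of_nonneg_left hb hq0.le
      have h2 : q * (a / q) = a := by field_simp
      nlinarith
    have h3 : p * (b / p) = b := by field_simp
    have := mul_le_mul_of_nonneg_left h1 hp0.le
    nlinarith
  have ha' : a / q ≤ k * (p + 1) / (p * q - 1) + (β + p * α) / (p * q - 1) * L := by
    rw [← mul_div_right_comm, ← add_div, div_le_div_iff₀ hq0 hD]
    have h1 : p * a ≤ p * k + (k + a / q + β * L) + p * α * L := by
      have := mul_le_mul_of_nonneg_left ha hp0.le
      have h2 : p * (b / p) = b := by field_simp
      nlinarith
    have h3 : q * (a / q) = a := by field_simp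
    have := mul_le_mul_of_nonneg_left h1 hq0.le
    nlinarith
  have hkq : k * (1 + (p + q + 1) / (p * q - 1))
      = k + k * (q + 1) / (p * q - 1) + k * p / (p * q - 1) := by ring
  have hkp : k * (1 + (p + q + 1) / (p * q - 1))
      = k + k * (p + 1) / (p * q - 1) + k * q / (p * q - 1) := by ring
  have hp1 : 0 ≤ k * p / (p * q - 1) := by positivity
  have hq1 : 0 ≤ k * q / (p * q - 1) := by positivity
  have e1 : (2 + 1 / p) / (p * q - 1) - (n - 1) / 2
      = -((n - n / p - 1 - (n - 1) / 2) + (α + q * β) / (p * q - 1)) := by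
    rw [hα, hβ]; field_simp; ring
  have e3 : (2 + q) / (p * q - 1) - n + 1 = -(α + (α + q * β) / (p * q - 1)) := by
    have : α + q * β = (p * q - 1) * ((n + 1) / p) - (2 + q) := by
      rw [hα, hβ]; field_simp; ring
    rw [this, sub_div, mul_div_cancel_left₀ _ hD.ne', hα]; ring
  have e4 : (1 + 2 * p) / (p * q - 1) - n = -(β + (β + p * α) / (p * q - 1)) := by
    rw [hα, hβ]; field_simp; ring
  refine ⟨?_, ?_, ?_⟩
  · rw [e1, hkq]; linarith
  · rw [e3, hkq]; linarith
  · rw [e4, hkp]; linarith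

lemma log_le_of_mul_le {c k ε T e A r κ : ℝ} (hc : 0 < c) (hk : 0 < k) (hε : 0 < ε) (hT : 0 < T)
    (hA : 0 < A) (hκ : |log c| + |log k| ≤ κ) (h : c * ε ≤ k * T ^ e * A ^ (1 / r)) :
    log ε ≤ κ + log A / r + e * log T := by
  have h1 := Real.log_le_log (by positivity) h
  rw [Real.log_mul hc.ne' hε.ne', Real.log_mul (by positivity) (by positivity),
    Real.log_mul hk.ne' (by positivity), Real.log_rpow hT, Real.log_rpow hA] at h1
  have := neg_abs_le (log c)
  have := le_abs_self (log k)
  have : 1 / r * log A = log A / r := by ring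
  linarith

lemma lifespan_exponent_pos {n p q : ℝ}
    (h : max (max ((q / 2 + 1) / (p * q - 1)) ((2 + 1 / p) / (p * q - 1)))
      ((1 / 2 + p) / (p * q - 1) - 1 / 2) > (n - 1) / 2) :
    0 < max (max ((2 + 1 / p) / (p * q - 1) - (n - 1) / 2)
        ((1 + 2 / q) / (p * q - 1) - (n - 1) / q))
      (max ((2 + q) / (p * q - 1) - n + 1) ((1 + 2 * p) / (p * q - 1) - n)) := by
  rw [gt_iff_lt, lt_max_iff, lt_max_iff] at h
  rcases h with (h | h) | h
  · refine lt_max_of_lt_right (lt_max_of_lt_left ?_)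
    have : (2 + q) / (p * q - 1) = 2 * ((q / 2 + 1) / (p * q - 1)) := by ring
    linarith
  · exact lt_max_of_lt_left (lt_max_of_lt_left (by linarith))
  · refine lt_max_of_lt_right (lt_max_of_lt_right ?_)
    have : (1 + 2 * p) / (p * q - 1) = 2 * ((1 / 2 + p) / (p * q - 1)) := by ring
    linarith

lemma le_sub_lifespan_exponent_mul {n p q K x L : ℝ} (hq : 1 < q) (hL : 0 ≤ L)
    (hF : 0 < max (max ((2 + 1 / p) / (p * q - 1) - (n - 1) / 2)
        ((1 + 2 / q) / (p * q - 1) - (n - 1) / q))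
      (max ((2 + q) / (p * q - 1) - n + 1) ((1 + 2 * p) / (p * q - 1) - n)))
    (h1 : x ≤ K - ((2 + 1 / p) / (p * q - 1) - (n - 1) / 2) * L)
    (h3 : x ≤ K - ((2 + q) / (p * q - 1) - n + 1) * L)
    (h4 : x ≤ K - ((1 + 2 * p) / (p * q - 1) - n) * L) :
    x ≤ K - max (max ((2 + 1 / p) / (p * q - 1) - (n - 1) / 2)
        ((1 + 2 / q) / (p * q - 1) - (n - 1) / q))
      (max ((2 + q) / (p * q - 1) - n + 1) ((1 + 2 * p) / (p * q - 1) - n)) * L := by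
  set F₁ := (2 + 1 / p) / (p * q - 1) - (n - 1) / 2
  set F₂ := (1 + 2 / q) / (p * q - 1) - (n - 1) / q with hF2
  set F₃ := (2 + q) / (p * q - 1) - n + 1 with hF3
  set F₄ := (1 + 2 * p) / (p * q - 1) - n
  have hq0 : 0 < q := by linarith
  have h23 : F₃ = q * F₂ := by
    rw [hF2, hF3]; field_simp; ring
  rcases max_choice (max F₁ F₂) (max F₃ F₄) with h | h <;> rw [h] at hF ⊢
  · rcases max_choice F₁ F₂ with h' | h' <;> rw [h'] at hF ⊢
    · exact h1
    · have : F₂ ≤ F₃ := by rw [h23]; nlinarith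
      nlinarith
  · rcases max_choice F₃ F₄ with h' | h' <;> rw [h'] <;> assumption

lemma le_exp_mul_rpow_of_log_le {F K ε T : ℝ} (hF : 0 < F) (hε : 0 < ε) (hT : 0 < T)
    (h : log ε ≤ K - F * log T) : T ≤ exp (K / F) * ε ^ (-1 / F) := by
  rw [Real.rpow_def_of_pos hε, ← Real.exp_add, ← Real.log_le_iff_le_exp hT]
  have : K / F + log ε * (-1 / F) = (K - log ε) / F := by ring
  rw [this, le_div_iff₀ hF]
  linarith

/-- The system of estimates for the two weighted integrals `A`, `B` forces the lifespan bound. -/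
lemma exists_lifespan_bound {n p q c₁ c₂ c₃ k₁ k₂ k₃ : ℝ} (hp : 1 < p) (hq : 1 < q)
    (hF : 0 < max (max ((2 + 1 / p) / (p * q - 1) - (n - 1) / 2)
        ((1 + 2 / q) / (p * q - 1) - (n - 1) / q))
      (max ((2 + q) / (p * q - 1) - n + 1) ((1 + 2 * p) / (p * q - 1) - n)))
    (hc₁ : 0 < c₁) (hc₂ : 0 < c₂) (hc₃ : 0 < c₃) (hk₁ : 0 < k₁) (hk₂ : 0 < k₂) (hk₃ : 0 < k₃) :
    ∃ C ≥ 1, ∀ ε T A B : ℝ, 0 < ε → 1 ≤ T → 0 ≤ A → 0 ≤ B →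
      B + c₁ * ε ≤ k₁ * T ^ ((n + 1) * (1 - 1 / q) - 1) * A ^ (1 / q) →
      A + c₂ * ε ≤ k₂ * T ^ ((n + 1) * (1 - 1 / p) - 2) * B ^ (1 / p) →
      c₃ * ε ≤ k₃ * T ^ (n - n / p - 1 - (n - 1) / 2) * B ^ (1 / p) →
      T ≤ C * ε ^ (-1 / max (max ((2 + 1 / p) / (p * q - 1) - (n - 1) / 2)
        ((1 + 2 / q) / (p * q - 1) - (n - 1) / q))
      (max ((2 + q) / (p * q - 1) - n + 1) ((1 + 2 * p) / (p * q - 1) - n))) := by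
  set F := max (max ((2 + 1 / p) / (p * q - 1) - (n - 1) / 2)
        ((1 + 2 / q) / (p * q - 1) - (n - 1) / q))
      (max ((2 + q) / (p * q - 1) - n + 1) ((1 + 2 * p) / (p * q - 1) - n)) with hFdef
  set k := |log c₁| + |log c₂| + |log c₃| + |log k₁| + |log k₂| + |log k₃| with hk
  have hk0 : 0 ≤ k := by positivity
  have hD : 0 < p * q - 1 := by nlinarith
  have a1 := abs_nonneg (log c₁)
  have a2 := abs_nonneg (log c₂)
  have a3 := abs_nonneg (log c₃)
  have b1 := abs_nonneg (log k₁)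
  have b2 := abs_nonneg (log k₂)
  have b3 := abs_nonneg (log k₃)
  refine ⟨exp (k * (1 + (p + q + 1) / (p * q - 1)) / F), Real.one_le_exp (by positivity),
    fun ε T A B hε hT hA hB h1 h2 h3 => le_exp_mul_rpow_of_log_le hF hε (by linarith) ?_⟩
  have hT0 : 0 < T := by linarith
  have hne {r : ℝ} (hr : 1 < r) : 1 / r ≠ 0 := one_div_ne_zero (by linarith)
  have hA0 : 0 < A := hA.lt_of_ne fun h => by
    rw [← h, Real.zero_rpow (hne hq), mul_zero] at h1
    nlinarith
  have hB0 : 0 < B := hB.lt_of_ne fun h => by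
    rw [← h, Real.zero_rpow (hne hp), mul_zero] at h2
    nlinarith
  obtain ⟨g1, g3, g4⟩ := log_estimates (n := n) (L := log T) hp hq hk0
    (log_le_of_mul_le (κ := k) one_pos hk₂ hA0 hT0 hB0 (by simp; linarith) (by nlinarith))
    (log_le_of_mul_le (κ := k) one_pos hk₁ hB0 hT0 hA0 (by simp; linarith) (by nlinarith))
    (log_le_of_mul_le (κ := k) hc₁ hk₁ hε hT0 hA0 (by linarith) (by linarith))
    (log_le_of_mul_le (κ := k) hc₂ hk₂ hε hT0 hB0 (by linarith) (by linarith))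
    (log_le_of_mul_le (κ := k) hc₃ hk₃ hε hT0 hB0 (by linarith) (by linarith))
  exact le_sub_lifespan_exponent_mul hq (Real.log_nonneg hT) hF g1 g3 g4

end Lifespan

section Solution

variable {n : ℕ} {R : ℝ}

/-- A continuous nonnegative function supported in a ball has positive integral
unless it vanishes. -/
lemma integral_pos_of_supported {f : EuclideanSpace ℝ (Fin n) → ℝ} (hf : Continuous f)
    (hf0 : ∀ x, 0 ≤ f x) (hfR : ∀ x, R < ‖x‖ → f x = 0) {x₀ : EuclideanSpace ℝ (Fin n)}
    (hx₀ : f x₀ ≠ 0) : 0 < ∫ x, f x :=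
  hf.integral_pos_of_hasCompactSupport_nonneg_nonzero
    (HasCompactSupport.intro (isCompact_closedBall 0 R) fun x hx => hfR x (by simpa using hx))
    hf0 hx₀

lemma setIntegral_abs_rpow_mul_nonneg {T r : ℝ} {w : ℝ → EuclideanSpace ℝ (Fin n) → ℝ}
    {θ : ℝ → ℝ} (hθ : ∀ s, 0 ≤ θ s) :
    0 ≤ ∫ z in truncCone n R T, |w z.1 z.2| ^ r * θ (z.1 / T) :=
  setIntegral_nonneg measurableSet_truncCone fun _ _ =>
    mul_nonneg (Real.rpow_nonneg (abs_nonneg _) _) (hθ _)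

lemma dirDeriv_time_eq_deriv {w : ℝ → EuclideanSpace ℝ (Fin n) → ℝ}
    (hw : ContDiff ℝ 2 fun z : ℝ × EuclideanSpace ℝ (Fin n) => w z.1 z.2) (t : ℝ)
    (x : EuclideanSpace ℝ (Fin n)) :
    dirDeriv (fun z : ℝ × EuclideanSpace ℝ (Fin n) => w z.1 z.2) (1, 0) (t, x)
      = deriv (fun s => w s x) t :=
  (hasDerivAt_slice (W := fun z => w z.1 z.2) (hw.differentiable two_ne_zero (t, x))).deriv.symm

end Solution

end WaveEquation

theorem nakao_blowup_thm {n : ℕ} (hn : 1 ≤ n) {p q : ℝ} (hp : 1 < p) (hq : 1 < q)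
    (hpn : 3 ≤ n → p ≤ (n : ℝ) / ((n : ℝ) - 2)) (hqn : 3 ≤ n → q ≤ (n : ℝ) / ((n : ℝ) - 2))
    (hcond : max (max ((q / 2 + 1) / (p * q - 1)) ((2 + 1 / p) / (p * q - 1))) ((1 / 2 + p) / (p * q - 1) - 1 / 2) > ((n : ℝ) - 1) / 2)
    {R : ℝ} (hR : 0 < R) (u₀ u₁ v₀ v₁ : EuclideanSpace ℝ (Fin n) → ℝ)
    (hu₀c : Continuous u₀) (hu₁c : Continuous u₁) (hv₀c : Continuous v₀) (hv₁c : Continuous v₁)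
    (hu₀n : ∀ x, 0 ≤ u₀ x) (hu₁n : ∀ x, 0 ≤ u₁ x) (hv₀n : ∀ x, 0 ≤ v₀ x) (hv₁n : ∀ x, 0 ≤ v₁ x)
    (hu₀s : ∀ x, R < ‖x‖ → u₀ x = 0) (hu₁s : ∀ x, R < ‖x‖ → u₁ x = 0)
    (hv₀s : ∀ x, R < ‖x‖ → v₀ x = 0) (hv₁s : ∀ x, R < ‖x‖ → v₁ x = 0)
    (hu₀ne : u₀ ≠ 0) (hv₁ne : v₁ ≠ 0) :
    ∃ ε₀ > (0:ℝ), ∃ C > (0:ℝ), ∀ ε : ℝ, 0 < ε → ε ≤ ε₀ → ∀ T > (0:ℝ),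
      ∀ u v : ℝ → EuclideanSpace ℝ (Fin n) → ℝ,
        IsNakaoSolution p q T u v →
        (∀ x, u 0 x = ε * u₀ x) → (∀ x, deriv (fun s => u s x) 0 = ε * u₁ x) →
        (∀ x, v 0 x = ε * v₀ x) → (∀ x, deriv (fun s => v s x) 0 = ε * v₁ x) →
        (∀ t ∈ Set.Ico (0:ℝ) T, ∀ x, R + t < ‖x‖ → u t x = 0) →
        (∀ t ∈ Set.Ico (0:ℝ) T, ∀ x, R + t < ‖x‖ → v t x = 0) →
        T ≤ C * ε ^ (-1 / max (max ((2 + 1 / p) / (p * q - 1) - ((n : ℝ) - 1) / 2) ((1 + 2 / q) / (p * q - 1) - ((n : ℝ) - 1) / q)) (max ((2 + q) / (p * q - 1) - (n : ℝ) + 1)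
                            ((1 + 2 * p) / (p * q - 1) - (n : ℝ)))) := by
  have hqinv : 0 < 1 / q := by positivity
  have hpinv : 0 < 1 / p := by positivity
  obtain ⟨Cη, η, hη⟩ := exists_isTimeCutoff (a := max (1 / p) (1 / q))
    (lt_max_of_lt_left hpinv)
    (max_lt ((div_lt_one (by linarith)).2 hp) ((div_lt_one (by linarith)).2 hq))
  have hηp := hη.mono hpinv.le (le_max_left _ _)
  have hηq := hη.mono hqinv.le (le_max_right _ _)
  obtain ⟨k₁, hk₁, est₁⟩ := exists_damped_estimate (n := n) hR hq hηq
  obtain ⟨k₂, hk₂, est₂⟩ := exists_wave_estimate (n := n) hR hp hηp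
  obtain ⟨Ψ₀, hΨ₀c, hΨ₀, k₃, hk₃, est₃⟩ := exists_waveKernel_estimate hn hR hp hηp
  obtain ⟨y, hy⟩ := Function.ne_iff.1 hu₀ne
  obtain ⟨w, hw⟩ := Function.ne_iff.1 hv₁ne
  have hwR : ‖w‖ ≤ R := not_lt.1 fun h => hw (hv₁s w h)
  have hc₁ : 0 < (∫ x, u₁ x) + ∫ x, u₀ x :=
    add_pos_of_nonneg_of_pos (MeasureTheory.integral_nonneg hu₁n)
      (integral_pos_of_supported hu₀c hu₀n hu₀s hy)
  have hc₂ : 0 < ∫ x, v₁ x := integral_pos_of_supported hv₁c hv₁n hv₁s hw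
  have hc₃ : 0 < ∫ x, v₁ x * Ψ₀ x := by
    refine integral_pos_of_supported (R := R) (hv₁c.mul hΨ₀c) (fun x => ?_)
      (fun x hx => by simp [hv₁s x hx]) (x₀ := w) (mul_ne_zero hw (hΨ₀ w hwR).ne')
    rcases le_or_gt ‖x‖ R with hx | hx
    · exact mul_nonneg (hv₁n x) (hΨ₀ x hx).le
    · simp [hv₁s x hx]
  have hF := lifespan_exponent_pos hcond
  obtain ⟨C, hC, hbound⟩ := exists_lifespan_bound hp hq hF hc₁ hc₂ hc₃ hk₁ hk₂ hk₃
  refine ⟨1, one_pos, C, by linarith, fun ε hε hε1 T hT u v hsol hu0 hu1 hv0 hv1 hus hvs => ?_⟩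
  rcases lt_or_ge T 1 with hT1 | hT1
  · refine hT1.le.trans (one_le_mul_of_one_le_of_one_le hC ?_)
    exact Real.one_le_rpow_of_pos_of_le_one_of_nonpos hε hε1
      (div_nonpos_of_nonpos_of_nonneg (by norm_num) hF.le)
  obtain ⟨huC, hvC, hequ, heqv⟩ := hsol
  have hext {f : ℝ → EuclideanSpace ℝ (Fin n) → ℝ}
      (hf : ∀ t ∈ Set.Ico (0 : ℝ) T, ∀ x, R + t < ‖x‖ → f t x = 0) :
      ∀ z ∈ coneExterior n R T, f z.1 z.2 = 0 :=
    fun z hz => hf z.1 ⟨hz.1.le, hz.2.1⟩ z.2 hz.2.2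
  have huK : ∀ z ∈ truncCone n R T, dAlembert (fun z => u z.1 z.2) z
      + dirDeriv (fun z : ℝ × EuclideanSpace ℝ (Fin n) => u z.1 z.2) (1, 0) z
        = |v z.1 z.2| ^ p := by
    rintro ⟨t, x⟩ hz
    rw [← deriv_deriv_sub_laplacian_eq_dAlembert huC, dirDeriv_time_eq_deriv huC]
    exact hequ t ⟨hz.1.le, hz.2.1⟩ x
  have hvK : ∀ z ∈ truncCone n R T, dAlembert (fun z => v z.1 z.2) z = |u z.1 z.2| ^ q := by
    rintro ⟨t, x⟩ hz
    rw [← deriv_deriv_sub_laplacian_eq_dAlembert hvC]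
    exact heqv t ⟨hz.1.le, hz.2.1⟩ x
  have h₁ := est₁ T hT1 _ _ huC (hext hus) huK
  have h₂ := est₂ T hT1 _ _ hvC (hext hvs) hvK
  have h₃ := est₃ T hT1 _ hvC (hext hvs)
    (fun z hz => by rw [hvK z hz]; exact Real.rpow_nonneg (abs_nonneg _) _)
    (fun x => by simpa only [hv0] using mul_nonneg hε.le (hv₀n x))
    (fun x hx => by simp only [hv0, hv₀s x hx, mul_zero])
    (fun x hx => by rw [dirDeriv_time_eq_deriv hvC, hv1, hv₁s x hx, mul_zero])
  simp only [dirDeriv_time_eq_deriv huC, hu0, hu1, MeasureTheory.integral_const_mul] at h₁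
  simp only [dirDeriv_time_eq_deriv hvC, hv1, MeasureTheory.integral_const_mul] at h₂
  simp only [dirDeriv_time_eq_deriv hvC, hv1, mul_assoc ε,
    MeasureTheory.integral_const_mul] at h₃
  exact hbound ε T _ _ hε hT1 (setIntegral_abs_rpow_mul_nonneg hη.nonneg)
    (setIntegral_abs_rpow_mul_nonneg hη.nonneg) ((by ring : _ = _).trans_le h₁)
    ((by ring : _ = _).trans_le h₂) ((by ring : _ = _).trans_le h₃)
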